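/- Let n ≥ 2, let U ⊆ ℝⁿ be open, let Ω ⊆ ℝⁿ be a bounded open set whose closure is contained in U, and let φ : U → ℝ be a smooth limiting Carleman weight on U. Let X : U → ℝⁿ be a smooth vector field and q : U → ℂ a smooth function. Then there exist constants C > 0 and h₀ ∈ (0, 1] such that for every h ∈ (0, h₀] and every smooth compactly supported u : ℝⁿ → ℂ with support contained in Ω, one has ‖e^{φ/h} u‖_{L²(Ω)} + ‖ h∇(e^{φ/h} u) ‖_{L²(Ω)} ≤ C·h·‖ e^{φ/h} ( Δu + ⟨X, ∇u⟩ + q·u ) ‖_{L²(Ω)}, where Δu denotes the Euclidean Laplacian of u, ∇u its gradient, and ‖·‖_{L²(Ω)} the L² norm with respect to Lebesgue measure on Ω. -/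

import Mathlib

open RealInnerProductSpace
noncomputable section

/-- The Hessian bilinear form of `φ` at `x`, i.e. the second (Fréchet) derivative
viewed as a bilinear form. -/
def Hess {n : ℕ} (φ : EuclideanSpace ℝ (Fin n) → ℝ) (x X Y : EuclideanSpace ℝ (Fin n)) : ℝ :=
  iteratedFDeriv ℝ 2 φ x ![X, Y]

/-- `φ` is a limiting Carleman weight on `Ω ⊆ ℝⁿ` (Euclidean metric): its gradient is
nonvanishing on `Ω` and for every `x ∈ Ω` and every `X` with `|X| = |∇φ(x)|` and
`⟨X, ∇φ(x)⟩ = 0` one has `D²φ(x)(X,X) + D²φ(x)(∇φ(x),∇φ(x)) = 0`. -/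
def IsLCW {n : ℕ} (Ω : Set (EuclideanSpace ℝ (Fin n))) (φ : EuclideanSpace ℝ (Fin n) → ℝ) :
    Prop :=
  (∀ x ∈ Ω, gradient φ x ≠ 0) ∧
  ∀ x ∈ Ω, ∀ X : EuclideanSpace ℝ (Fin n),
    ‖X‖ = ‖gradient φ x‖ → ⟪X, gradient φ x⟫ = 0 →
    Hess φ x X X + Hess φ x (gradient φ x) (gradient φ x) = 0

/-- Euclidean Laplacian of a complex-valued function: the trace of the Hessian. -/
def eLap {n : ℕ} (u : EuclideanSpace ℝ (Fin n) → ℂ) (x : EuclideanSpace ℝ (Fin n)) : ℂ :=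
  ∑ j : Fin n,
    iteratedFDeriv ℝ 2 u x ![EuclideanSpace.single j 1, EuclideanSpace.single j 1]

/-- The `L²(Ω)` norm of the pointwise-norm function `g`. -/
def L2norm {n : ℕ} (Ω : Set (EuclideanSpace ℝ (Fin n))) (g : EuclideanSpace ℝ (Fin n) → ℝ) :
    ℝ :=
  (∫ x in Ω, (g x) ^ 2) ^ (1 / 2 : ℝ)

open scoped ContDiff Topology
open MeasureTheory

variable {n : ℕ}

/-- The partial derivative of `f` in the `i`-th coordinate direction. -/
def partialDeriv (i : Fin n) (f : EuclideanSpace ℝ (Fin n) → ℝ) (x : EuclideanSpace ℝ (Fin n)) :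
    ℝ :=
  fderiv ℝ f x (EuclideanSpace.single i 1)

section partialDeriv

variable {f g : EuclideanSpace ℝ (Fin n) → ℝ} {x : EuclideanSpace ℝ (Fin n)} {i j : Fin n}

theorem ContDiff.partialDeriv (hf : ContDiff ℝ ∞ f) (i : Fin n) :
    ContDiff ℝ ∞ (partialDeriv i f) :=
  (hf.fderiv_right (m := ∞) (by simp)).clm_apply contDiff_const

theorem ContDiff.differentiableAt_real (hf : ContDiff ℝ ∞ f) : DifferentiableAt ℝ f x :=
  hf.differentiable (by simp) x

theorem partialDeriv_add (hf : ContDiff ℝ ∞ f) (hg : ContDiff ℝ ∞ g) :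
    partialDeriv i (fun y => f y + g y) x = partialDeriv i f x + partialDeriv i g x := by
  simp only [partialDeriv]
  rw [fderiv_fun_add hf.differentiableAt_real hg.differentiableAt_real]
  rfl

theorem partialDeriv_sub (hf : ContDiff ℝ ∞ f) (hg : ContDiff ℝ ∞ g) :
    partialDeriv i (fun y => f y - g y) x = partialDeriv i f x - partialDeriv i g x := by
  simp only [partialDeriv]
  rw [fderiv_fun_sub hf.differentiableAt_real hg.differentiableAt_real]
  rfl

theorem partialDeriv_mul (hf : ContDiff ℝ ∞ f) (hg : ContDiff ℝ ∞ g) :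
    partialDeriv i (fun y => f y * g y) x =
      partialDeriv i f x * g x + f x * partialDeriv i g x := by
  simp only [partialDeriv]
  rw [fderiv_fun_mul hf.differentiableAt_real hg.differentiableAt_real]
  simp
  ring

theorem partialDeriv_const (c : ℝ) : partialDeriv i (fun _ => c) x = 0 := by
  simp [partialDeriv]

theorem partialDeriv_const_mul (hf : ContDiff ℝ ∞ f) (c : ℝ) :
    partialDeriv i (fun y => c * f y) x = c * partialDeriv i f x := by
  rw [partialDeriv_mul contDiff_const hf, partialDeriv_const]
  ring

theorem partialDeriv_sum {F : Fin n → EuclideanSpace ℝ (Fin n) → ℝ}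
    (hF : ∀ j, ContDiff ℝ ∞ (F j)) :
    partialDeriv i (fun y => ∑ j, F j y) x = ∑ j, partialDeriv i (F j) x := by
  simp only [partialDeriv]
  rw [fderiv_fun_sum fun j _ => (hF j).differentiableAt_real]
  simp

theorem partialDeriv_exp (hf : ContDiff ℝ ∞ f) :
    partialDeriv i (fun y => Real.exp (f y)) x = Real.exp (f x) * partialDeriv i f x := by
  simp only [partialDeriv]
  rw [fderiv_exp hf.differentiableAt_real]
  simp

theorem partialDeriv_partialDeriv_eq (hf : ContDiff ℝ ∞ f) :
    partialDeriv i (partialDeriv j f) x =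
      fderiv ℝ (fderiv ℝ f) x (EuclideanSpace.single i 1) (EuclideanSpace.single j 1) := by
  have h : DifferentiableAt ℝ (fderiv ℝ f) x :=
    (hf.fderiv_right (m := ∞) (by simp)).differentiable (by simp) x
  unfold partialDeriv
  rw [fderiv_clm_apply h (by fun_prop)]
  simp

theorem partialDeriv_comm (hf : ContDiff ℝ ∞ f) :
    partialDeriv i (partialDeriv j f) x = partialDeriv j (partialDeriv i f) x := by
  rw [partialDeriv_partialDeriv_eq hf, partialDeriv_partialDeriv_eq hf]
  exact (hf.contDiffAt.isSymmSndFDerivAt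
    (by simpa using (WithTop.coe_le_coe.2 le_top : ((2 : ℕ∞) : WithTop ℕ∞) ≤ ∞))) _ _

theorem integral_partialDeriv_eq_zero (hf : ContDiff ℝ ∞ f) (hs : HasCompactSupport f) :
    ∫ x, partialDeriv i f x = 0 := by
  have hi : Integrable (fun x => fderiv ℝ f x (EuclideanSpace.single i 1)) :=
    (hf.partialDeriv i).continuous.integrable_of_hasCompactSupport
      (hs.fderiv_apply (𝕜 := ℝ) _)
  have := integral_mul_fderiv_eq_neg_fderiv_mul_of_integrable (𝕜 := ℝ) (μ := volume)
    (f := fun _ : EuclideanSpace ℝ (Fin n) => (1 : ℝ)) (g := f)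
    (v := EuclideanSpace.single i 1) (by simp) (by simpa using hi)
    (by simpa using hf.continuous.integrable_of_hasCompactSupport hs)
    (fun _ _ => by fun_prop) (fun _ _ => hf.differentiableAt_real)
  simpa [partialDeriv] using this

end partialDeriv

/-- A smooth function on an open neighbourhood of a closed set agrees near that set with a globally
smooth function. -/
theorem ContDiffOn.exists_contDiff_eq_nhdsSet {F : Type*} [NormedAddCommGroup F]
    [NormedSpace ℝ F] {f : EuclideanSpace ℝ (Fin n) → F}
    {K W : Set (EuclideanSpace ℝ (Fin n))} (hK : IsClosed K) (hW : IsOpen W) (hKW : K ⊆ W)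
    (hf : ContDiffOn ℝ ∞ f W) :
    ∃ g : EuclideanSpace ℝ (Fin n) → F, ContDiff ℝ ∞ g ∧ ∀ᶠ x in 𝓝ˢ K, g x = f x := by
  obtain ⟨χ, h0, h1, -⟩ := exists_contMDiffMap_zero_one_nhds_of_isClosed
    (n := (⊤ : ℕ∞)) (modelWithCornersSelf ℝ (EuclideanSpace ℝ (Fin n))) hW.isClosed_compl hK
    (Set.disjoint_left.2 fun x hx hxK => hx (hKW hxK))
  have hχ : ContDiff ℝ ∞ χ := χ.contMDiff.contDiff
  refine ⟨fun x => χ x • f x, contDiff_iff_contDiffAt.2 fun x => ?_, ?_⟩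
  · by_cases hx : x ∈ W
    · exact hχ.contDiffAt.smul (hf.contDiffAt (hW.mem_nhds hx))
    · refine (contDiffAt_const (c := (0 : F))).congr_of_eventuallyEq ?_
      filter_upwards [(eventually_nhdsSet_iff_forall.1 h0) x hx] with y hy
      simp [hy]
  · filter_upwards [h1] with x hx
    simp [hx]

section DivergenceIdentity

variable {Ψ β v : EuclideanSpace ℝ (Fin n) → ℝ} {x : EuclideanSpace ℝ (Fin n)}

/-- The Laplacian of a real-valued function as a sum of second partial derivatives. -/
def laplace (f : EuclideanSpace ℝ (Fin n) → ℝ) (x : EuclideanSpace ℝ (Fin n)) : ℝ :=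
  ∑ i, partialDeriv i (partialDeriv i f) x

/-- The dot product of the gradients of two real-valued functions. -/
def gradDot (f g : EuclideanSpace ℝ (Fin n) → ℝ) (x : EuclideanSpace ℝ (Fin n)) : ℝ :=
  ∑ i, partialDeriv i f x * partialDeriv i g x

/-- The quadratic form of the Hessian of `f` evaluated on the gradient of `g`. -/
def hessGrad (f g : EuclideanSpace ℝ (Fin n) → ℝ) (x : EuclideanSpace ℝ (Fin n)) : ℝ :=
  ∑ i, ∑ j, partialDeriv i (partialDeriv j f) x * partialDeriv i g x * partialDeriv j g x

theorem ContDiff.laplace (hf : ContDiff ℝ ∞ v) : ContDiff ℝ ∞ (laplace v) :=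
  ContDiff.sum fun i _ => (hf.partialDeriv i).partialDeriv i

theorem ContDiff.gradDot (hf : ContDiff ℝ ∞ Ψ) (hg : ContDiff ℝ ∞ v) :
    ContDiff ℝ ∞ (gradDot Ψ v) :=
  ContDiff.sum fun i _ => (hf.partialDeriv i).mul (hg.partialDeriv i)

theorem partialDeriv_gradDot (hf : ContDiff ℝ ∞ Ψ) (hg : ContDiff ℝ ∞ v) (i : Fin n) :
    partialDeriv i (gradDot Ψ v) x =
      ∑ j, (partialDeriv i (partialDeriv j Ψ) x * partialDeriv j v x +
        partialDeriv j Ψ x * partialDeriv i (partialDeriv j v) x) := by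
  unfold gradDot
  rw [partialDeriv_sum fun j => (hf.partialDeriv j).mul (hg.partialDeriv j)]
  exact Finset.sum_congr rfl fun j _ =>
    partialDeriv_mul (hf.partialDeriv j) (hg.partialDeriv j)

/-- The `i`-th component of the flux whose divergence relates the product of the symmetric and
antisymmetric parts of the conjugated Laplacian to a quadratic form. -/
def carlemanFlux (Ψ β v : EuclideanSpace ℝ (Fin n) → ℝ) (i : Fin n)
    (x : EuclideanSpace ℝ (Fin n)) : ℝ :=
  -4 * (gradDot Ψ v x * partialDeriv i v x) + 2 * (gradDot v v x * partialDeriv i Ψ x) -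
    2 * (β x * v x * partialDeriv i v x) -
    2 * (gradDot Ψ Ψ x * (v x * v x) * partialDeriv i Ψ x)

theorem ContDiff.carlemanFlux (hΨ : ContDiff ℝ ∞ Ψ) (hβ : ContDiff ℝ ∞ β)
    (hv : ContDiff ℝ ∞ v) (i : Fin n) : ContDiff ℝ ∞ (carlemanFlux Ψ β v i) := by
  have h1 := (hΨ.gradDot hv).mul (hv.partialDeriv i)
  have h2 := (hv.gradDot hv).mul (hΨ.partialDeriv i)
  have h3 := (hβ.mul hv).mul (hv.partialDeriv i)
  have h4 := ((hΨ.gradDot hΨ).mul (hv.mul hv)).mul (hΨ.partialDeriv i)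
  exact (((contDiff_const.mul h1).add (contDiff_const.mul h2)).sub
    (contDiff_const.mul h3)).sub (contDiff_const.mul h4)

theorem partialDeriv_carlemanFlux (hΨ : ContDiff ℝ ∞ Ψ) (hβ : ContDiff ℝ ∞ β)
    (hv : ContDiff ℝ ∞ v) (i : Fin n) :
    partialDeriv i (carlemanFlux Ψ β v i) x =
      -4 * (partialDeriv i (gradDot Ψ v) x * partialDeriv i v x +
        gradDot Ψ v x * partialDeriv i (partialDeriv i v) x) +
      2 * (partialDeriv i (gradDot v v) x * partialDeriv i Ψ x +
        gradDot v v x * partialDeriv i (partialDeriv i Ψ) x) -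
      2 * ((partialDeriv i β x * v x + β x * partialDeriv i v x) * partialDeriv i v x +
        β x * v x * partialDeriv i (partialDeriv i v) x) -
      2 * ((partialDeriv i (gradDot Ψ Ψ) x * (v x * v x) + gradDot Ψ Ψ x *
          (partialDeriv i v x * v x + v x * partialDeriv i v x)) * partialDeriv i Ψ x +
        gradDot Ψ Ψ x * (v x * v x) * partialDeriv i (partialDeriv i Ψ) x) := by
  have h1 := (hΨ.gradDot hv).mul (hv.partialDeriv i)
  have h2 := (hv.gradDot hv).mul (hΨ.partialDeriv i)
  have h3 := (hβ.mul hv).mul (hv.partialDeriv i)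
  have h4 := ((hΨ.gradDot hΨ).mul (hv.mul hv)).mul (hΨ.partialDeriv i)
  unfold carlemanFlux
  rw [partialDeriv_sub (((contDiff_const.mul h1).add (contDiff_const.mul h2)).sub
      (contDiff_const.mul h3)) (contDiff_const.mul h4),
    partialDeriv_sub ((contDiff_const.mul h1).add (contDiff_const.mul h2))
      (contDiff_const.mul h3),
    partialDeriv_add (contDiff_const.mul h1) (contDiff_const.mul h2),
    partialDeriv_const_mul h1, partialDeriv_const_mul h2, partialDeriv_const_mul h3,
    partialDeriv_const_mul h4,
    partialDeriv_mul (hΨ.gradDot hv) (hv.partialDeriv i),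
    partialDeriv_mul (hv.gradDot hv) (hΨ.partialDeriv i),
    partialDeriv_mul (hβ.mul hv) (hv.partialDeriv i), partialDeriv_mul hβ hv,
    partialDeriv_mul ((hΨ.gradDot hΨ).mul (hv.mul hv)) (hΨ.partialDeriv i),
    partialDeriv_mul (hΨ.gradDot hΨ) (hv.mul hv), partialDeriv_mul hv hv]

theorem sum_partialDeriv_carlemanFlux (hΨ : ContDiff ℝ ∞ Ψ) (hβ : ContDiff ℝ ∞ β)
    (hv : ContDiff ℝ ∞ v) :
    ∑ i, partialDeriv i (carlemanFlux Ψ β v i) x =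
      2 * (laplace v x + gradDot Ψ Ψ x * v x) * (-2 * gradDot Ψ v x - β x * v x) -
      (4 * hessGrad Ψ v x + 4 * hessGrad Ψ Ψ x * v x ^ 2 +
        2 * (β x - laplace Ψ x) * (gradDot v v x - gradDot Ψ Ψ x * v x ^ 2) +
        2 * v x * gradDot β v x) := by
  have e1 : ∑ i, partialDeriv i (gradDot Ψ v) x * partialDeriv i v x =
      hessGrad Ψ v x + ∑ i, ∑ j,
        partialDeriv i (partialDeriv j v) x * partialDeriv j Ψ x * partialDeriv i v x := by
    simp only [partialDeriv_gradDot hΨ hv, hessGrad, ← Finset.sum_add_distrib, Finset.sum_mul]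
    exact Finset.sum_congr rfl fun i _ => Finset.sum_congr rfl fun j _ => by ring
  have e2 : ∑ i, partialDeriv i (gradDot v v) x * partialDeriv i Ψ x =
      2 * ∑ i, ∑ j,
        partialDeriv i (partialDeriv j v) x * partialDeriv j Ψ x * partialDeriv i v x := by
    rw [Finset.sum_comm]
    simp only [partialDeriv_gradDot hv hv, Finset.mul_sum, Finset.sum_mul]
    refine Finset.sum_congr rfl fun i _ => Finset.sum_congr rfl fun j _ => ?_
    rw [partialDeriv_comm hv (i := j) (j := i)]
    ring
  have e3 : ∑ i, partialDeriv i (gradDot Ψ Ψ) x * partialDeriv i Ψ x = 2 * hessGrad Ψ Ψ x := by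
    simp only [partialDeriv_gradDot hΨ hΨ, hessGrad, Finset.mul_sum, Finset.sum_mul]
    exact Finset.sum_congr rfl fun i _ => Finset.sum_congr rfl fun j _ => by ring
  have key : ∑ i, partialDeriv i (carlemanFlux Ψ β v i) x =
      -4 * ∑ i, partialDeriv i (gradDot Ψ v) x * partialDeriv i v x
      - 4 * gradDot Ψ v x * laplace v x
      + 2 * ∑ i, partialDeriv i (gradDot v v) x * partialDeriv i Ψ x
      + 2 * gradDot v v x * laplace Ψ x
      - 2 * v x * gradDot β v x - 2 * β x * gradDot v v x - 2 * β x * v x * laplace v x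
      - 2 * v x ^ 2 * ∑ i, partialDeriv i (gradDot Ψ Ψ) x * partialDeriv i Ψ x
      - 4 * gradDot Ψ Ψ x * v x * gradDot Ψ v x
      - 2 * gradDot Ψ Ψ x * v x ^ 2 * laplace Ψ x := by
    simp only [partialDeriv_carlemanFlux hΨ hβ hv]
    conv_rhs =>
      rw [laplace, laplace, gradDot.eq_1 β v]
      enter [1, 2, 2]
      rw [gradDot]
    rw [show (2 * β x * gradDot v v x) =
      2 * β x * ∑ i, partialDeriv i v x * partialDeriv i v x from rfl]
    simp only [Finset.mul_sum, ← Finset.sum_add_distrib, ← Finset.sum_sub_distrib]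
    exact Finset.sum_congr rfl fun i _ => by ring
  rw [key, e1, e2, e3]
  ring

theorem sum_partialDeriv_mul_partialDeriv (hv : ContDiff ℝ ∞ v) :
    ∑ i, partialDeriv i (fun y => v y * partialDeriv i v y) x =
      v x * laplace v x + gradDot v v x := by
  simp only [partialDeriv_mul hv (hv.partialDeriv _), laplace, gradDot, Finset.mul_sum,
    ← Finset.sum_add_distrib]
  exact Finset.sum_congr rfl fun i _ => by ring

end DivergenceIdentity

section PointwiseEstimate

theorem carleman_algebraic_estimate {v A B T s γ τ a G N₂ νg wg bg β m M : ℝ}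
    (hm : 0 < m) (hm1 : m ≤ 1) (hM : 1 ≤ M) (hγ : 0 < γ) (hγτ : γ ≤ τ)
    (hs : τ / 2 ≤ s) (hs' : s ≤ 2 * τ) (ha : |a| ≤ M) (hN : m ≤ N₂) (hN' : N₂ ≤ M)
    (hwg : wg ^ 2 ≤ M ^ 2 * G) (hbg : bg ^ 2 ≤ (4 * M ^ 2 * τ) ^ 2 * G)
    (hβ : |β| ≤ 3 * M * τ) (hB : B = -2 * s * νg - β * v) (hT : T = A + B - 2 * s * a * v) :
    (m ^ 2 / (8 * M) * γ - 100 * M ^ 4) * (τ ^ 2 * v ^ 2 + G) +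
        (2 * A * B - (8 * s * νg * wg + 4 * γ * νg ^ 2 + 4 * γ * s ^ 2 * N₂ ^ 2 * v ^ 2 +
          2 * v * bg)) -
        m ^ 2 / (8 * M) * γ * (v * A - s ^ 2 * N₂ * v ^ 2 + G) ≤ 2 * T ^ 2 := by
  have hτ : 0 < τ := hγ.trans_le hγτ
  have hG : 0 ≤ G := by
    by_contra! h
    have : M ^ 2 * G < 0 := mul_neg_of_pos_of_neg (by positivity) h
    nlinarith [sq_nonneg wg]
  set k := m ^ 2 / (8 * M) with hk
  have hkM : k * (8 * M) = m ^ 2 := by rw [hk]; field_simp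
  have hk0 : 0 < k := by positivity
  have hk1 : k ≤ 1 := by
    rw [hk, div_le_one (by positivity)]; nlinarith
  have hM2 : 1 ≤ M ^ 2 := by nlinarith
  have hM4 : M ^ 2 ≤ M ^ 4 := by nlinarith
  have hs0 : 0 < s := by linarith
  have hs2 : s ^ 2 ≤ 4 * τ ^ 2 := by nlinarith
  have hs2' : τ ^ 2 ≤ 4 * s ^ 2 := by nlinarith
  have ha2 : a ^ 2 ≤ M ^ 2 := sq_le_sq' (by linarith [neg_abs_le a]) ((le_abs_self a).trans ha)
  have hβ2 : β ^ 2 ≤ (3 * M * τ) ^ 2 :=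
    sq_le_sq' (by linarith [neg_abs_le β]) ((le_abs_self β).trans hβ)
  have hv2 := sq_nonneg v
  have hN0 : 0 ≤ N₂ := hm.le.trans hN
  have h1 : (A + B) ^ 2 ≤ 2 * T ^ 2 + 32 * M ^ 2 * (τ ^ 2 * v ^ 2) := by
    have h : (s ^ 2 * a ^ 2) * v ^ 2 ≤ (4 * τ ^ 2 * M ^ 2) * v ^ 2 := by gcongr
    have : A + B = T + 2 * s * a * v := by rw [hT]; ring
    rw [this]
    linarith [sq_nonneg (T - 2 * s * a * v)]
  have h2 : -(B ^ 2 + 6 * M ^ 2 * G + 18 * M ^ 2 * (τ ^ 2 * v ^ 2)) ≤ 8 * s * νg * wg := by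
    have e : 8 * s * νg * wg = -4 * B * wg - 4 * (β * v) * wg := by rw [hB]; ring
    have h : β ^ 2 * v ^ 2 ≤ (3 * M * τ) ^ 2 * v ^ 2 := by gcongr
    rw [e]
    linarith [sq_nonneg (B - 2 * wg), sq_nonneg (β * v - wg)]
  have h3 : γ * m ^ 2 * (τ ^ 2 * v ^ 2) ≤ 4 * γ * s ^ 2 * N₂ ^ 2 * v ^ 2 := by
    have : γ * m ^ 2 * (τ ^ 2 * v ^ 2) ≤ γ * N₂ ^ 2 * ((4 * s ^ 2) * v ^ 2) := by gcongr
    linarith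
  have h4 : -(τ ^ 2 * v ^ 2 + 16 * M ^ 4 * G) ≤ 2 * v * bg := by
    have h : (bg / τ) ^ 2 ≤ 16 * M ^ 4 * G := by
      rw [div_pow, div_le_iff₀ (by positivity)]
      linarith
    have e : 2 * v * bg = 2 * (τ * v) * (bg / τ) := by field_simp
    rw [e]
    linarith [sq_nonneg (τ * v + bg / τ)]
  have h5 : -(τ ^ 2 * v ^ 2) ≤ A ^ 2 + k * γ * (v * A) := by
    have h : (k * γ) ^ 2 ≤ τ ^ 2 := by
      have : k * γ ≤ 1 * τ := by gcongr
      exact pow_le_pow_left₀ (by positivity) (by linarith) 2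
    have h' : (k * γ) ^ 2 * v ^ 2 ≤ τ ^ 2 * v ^ 2 := by gcongr
    have h'' : 0 ≤ τ ^ 2 * v ^ 2 := by positivity
    linarith [sq_nonneg (2 * A + k * γ * v)]
  have h6 : k * γ * (s ^ 2 * N₂ * v ^ 2) ≤ γ * m ^ 2 / 2 * (τ ^ 2 * v ^ 2) := by
    have : k * γ * (s ^ 2 * N₂ * v ^ 2) ≤ k * γ * ((4 * τ ^ 2) * M * v ^ 2) := by gcongr
    have e : k * γ * ((4 * τ ^ 2) * M * v ^ 2) = γ * (k * (8 * M)) / 2 * (τ ^ 2 * v ^ 2) := by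
      ring
    rw [hkM] at e
    linarith
  have h7 : k * γ * (τ ^ 2 * v ^ 2) ≤ γ * m ^ 2 / 2 * (τ ^ 2 * v ^ 2) := by
    have h8 : k * 8 ≤ k * (8 * M) := by gcongr; linarith
    have hk2 : k ≤ m ^ 2 / 2 := by linarith [sq_nonneg m]
    have : k * γ ≤ m ^ 2 / 2 * γ := by gcongr
    have : k * γ ≤ γ * m ^ 2 / 2 := by linarith
    gcongr
  have h8 : 0 ≤ 4 * γ * νg ^ 2 := by positivity
  have h9 : M ^ 2 * G ≤ M ^ 4 * G := by gcongr
  have h10 : M ^ 2 * (τ ^ 2 * v ^ 2) ≤ M ^ 4 * (τ ^ 2 * v ^ 2) := by gcongr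
  have h11 : 1 * (τ ^ 2 * v ^ 2) ≤ M ^ 4 * (τ ^ 2 * v ^ 2) := by gcongr; linarith
  have h12 : 0 ≤ M ^ 4 * G := by positivity
  have h13 : 0 ≤ M ^ 4 * (τ ^ 2 * v ^ 2) := by positivity
  linarith

end PointwiseEstimate

section ConvexifiedWeight

variable {φ a v u : EuclideanSpace ℝ (Fin n) → ℝ} {x : EuclideanSpace ℝ (Fin n)} {τ γ : ℝ}

/-- The convexification `τ φ + γ φ² / 2` of the weight `τ φ`. -/
def convexWeight (τ γ : ℝ) (φ : EuclideanSpace ℝ (Fin n) → ℝ) (x : EuclideanSpace ℝ (Fin n)) : ℝ :=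
  τ * φ x + γ / 2 * (φ x * φ x)

theorem ContDiff.convexWeight (hφ : ContDiff ℝ ∞ φ) : ContDiff ℝ ∞ (convexWeight τ γ φ) :=
  (contDiff_const.mul hφ).add (contDiff_const.mul (hφ.mul hφ))

theorem ContDiff.convexSlope (hφ : ContDiff ℝ ∞ φ) : ContDiff ℝ ∞ fun y => τ + γ * φ y :=
  contDiff_const.add (contDiff_const.mul hφ)

theorem partialDeriv_convexSlope (hφ : ContDiff ℝ ∞ φ) (i : Fin n) :
    partialDeriv i (fun y => τ + γ * φ y) x = γ * partialDeriv i φ x := by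
  rw [partialDeriv_add contDiff_const (contDiff_const.mul hφ), partialDeriv_const,
    partialDeriv_const_mul hφ, zero_add]

theorem partialDeriv_convexWeight (hφ : ContDiff ℝ ∞ φ) (i : Fin n) :
    partialDeriv i (convexWeight τ γ φ) = fun y => (τ + γ * φ y) * partialDeriv i φ y := by
  funext y
  unfold convexWeight
  rw [partialDeriv_add (contDiff_const.mul hφ) (contDiff_const.mul (hφ.mul hφ)),
    partialDeriv_const_mul hφ, partialDeriv_const_mul (hφ.mul hφ), partialDeriv_mul hφ hφ]
  ring

theorem partialDeriv_partialDeriv_convexWeight (hφ : ContDiff ℝ ∞ φ) (i j : Fin n) :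
    partialDeriv i (partialDeriv j (convexWeight τ γ φ)) x =
      (τ + γ * φ x) * partialDeriv i (partialDeriv j φ) x +
        γ * (partialDeriv i φ x * partialDeriv j φ x) := by
  rw [partialDeriv_convexWeight hφ, partialDeriv_mul hφ.convexSlope (hφ.partialDeriv j),
    partialDeriv_convexSlope hφ]
  ring

theorem laplace_convexWeight (hφ : ContDiff ℝ ∞ φ) :
    laplace (convexWeight τ γ φ) x = (τ + γ * φ x) * laplace φ x + γ * gradDot φ φ x := by
  simp only [laplace, gradDot, partialDeriv_partialDeriv_convexWeight hφ, Finset.mul_sum,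
    ← Finset.sum_add_distrib]

theorem gradDot_convexWeight (hφ : ContDiff ℝ ∞ φ) :
    gradDot (convexWeight τ γ φ) v x = (τ + γ * φ x) * gradDot φ v x := by
  simp only [gradDot, partialDeriv_convexWeight hφ, Finset.mul_sum, mul_assoc]

theorem gradDot_convexWeight_self (hφ : ContDiff ℝ ∞ φ) :
    gradDot (convexWeight τ γ φ) (convexWeight τ γ φ) x =
      (τ + γ * φ x) ^ 2 * gradDot φ φ x := by
  simp only [gradDot, partialDeriv_convexWeight hφ, Finset.mul_sum]
  exact Finset.sum_congr rfl fun i _ => by ring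

theorem hessGrad_convexWeight (hφ : ContDiff ℝ ∞ φ) :
    hessGrad (convexWeight τ γ φ) v x =
      (τ + γ * φ x) * hessGrad φ v x + γ * gradDot φ v x ^ 2 := by
  have e : gradDot φ v x ^ 2 = ∑ i, ∑ j, partialDeriv i φ x * partialDeriv i v x *
      (partialDeriv j φ x * partialDeriv j v x) := by
    rw [sq, gradDot, Finset.sum_mul_sum]
  rw [e]
  simp only [hessGrad, partialDeriv_partialDeriv_convexWeight hφ, Finset.mul_sum,
    ← Finset.sum_add_distrib]
  exact Finset.sum_congr rfl fun i _ => Finset.sum_congr rfl fun j _ => by ring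

theorem hessGrad_convexWeight_self (hφ : ContDiff ℝ ∞ φ) :
    hessGrad (convexWeight τ γ φ) (convexWeight τ γ φ) x =
      (τ + γ * φ x) ^ 2 * ((τ + γ * φ x) * hessGrad φ φ x + γ * gradDot φ φ x ^ 2) := by
  rw [← hessGrad_convexWeight hφ]
  simp only [hessGrad, Finset.mul_sum]
  refine Finset.sum_congr rfl fun i _ => Finset.sum_congr rfl fun j _ => ?_
  rw [congrFun (partialDeriv_convexWeight hφ i) x, congrFun (partialDeriv_convexWeight hφ j) x]
  ring

theorem gradDot_sq_le (f g : EuclideanSpace ℝ (Fin n) → ℝ) (x : EuclideanSpace ℝ (Fin n)) :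
    gradDot f g x ^ 2 ≤ gradDot f f x * gradDot g g x := by
  have := Finset.sum_mul_sq_le_sq_mul_sq Finset.univ (fun i => partialDeriv i f x)
    fun i => partialDeriv i g x
  simpa only [gradDot, sq] using this

theorem gradDot_self_nonneg (f : EuclideanSpace ℝ (Fin n) → ℝ) (x : EuclideanSpace ℝ (Fin n)) :
    0 ≤ gradDot f f x :=
  Finset.sum_nonneg fun _ _ => mul_self_nonneg _

theorem partialDeriv_exp_mul {Ψ : EuclideanSpace ℝ (Fin n) → ℝ} (hΨ : ContDiff ℝ ∞ Ψ)
    (hu : ContDiff ℝ ∞ u) (i : Fin n) :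
    partialDeriv i (fun y => Real.exp (Ψ y) * u y) =
      fun y => Real.exp (Ψ y) * (partialDeriv i u y + partialDeriv i Ψ y * u y) := by
  funext y
  rw [partialDeriv_mul hΨ.exp hu, partialDeriv_exp hΨ]
  ring

/-- Conjugation of the Laplacian by an exponential weight. -/
theorem exp_mul_laplace {Ψ : EuclideanSpace ℝ (Fin n) → ℝ} (hΨ : ContDiff ℝ ∞ Ψ)
    (hu : ContDiff ℝ ∞ u) :
    Real.exp (Ψ x) * laplace u x =
      laplace (fun y => Real.exp (Ψ y) * u y) x -
        2 * gradDot Ψ (fun y => Real.exp (Ψ y) * u y) x +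
        gradDot Ψ Ψ x * (Real.exp (Ψ x) * u x) - laplace Ψ x * (Real.exp (Ψ x) * u x) := by
  simp only [laplace, gradDot, partialDeriv_exp_mul hΨ hu, Finset.mul_sum, Finset.sum_mul,
    ← Finset.sum_add_distrib, ← Finset.sum_sub_distrib]
  refine Finset.sum_congr rfl fun i _ => ?_
  rw [partialDeriv_mul hΨ.exp ((hu.partialDeriv i).add ((hΨ.partialDeriv i).mul hu)),
    partialDeriv_exp hΨ, partialDeriv_add (hu.partialDeriv i) ((hΨ.partialDeriv i).mul hu),
    partialDeriv_mul (hΨ.partialDeriv i) hu]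
  ring

/-- Quantitative data for a limiting Carleman weight `φ` on `Ω`: the Hessian of `φ` is
`a` times the identity up to the symmetric product of the gradient with the field `w`, and the
relevant quantities are bounded on `Ω`. -/
structure CarlemanBounds (Ω : Set (EuclideanSpace ℝ (Fin n)))
    (φ a : EuclideanSpace ℝ (Fin n) → ℝ) (w : Fin n → EuclideanSpace ℝ (Fin n) → ℝ)
    (m M : ℝ) : Prop where
  contDiff_weight : ContDiff ℝ ∞ φ
  contDiff_factor : ContDiff ℝ ∞ a
  pos : 0 < m
  le_one : m ≤ 1
  one_le : 1 ≤ M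
  abs_weight_le : ∀ x ∈ Ω, |φ x| ≤ M
  le_grad : ∀ x ∈ Ω, m ≤ gradDot φ φ x
  grad_le : ∀ x ∈ Ω, gradDot φ φ x ≤ M
  abs_factor_le : ∀ x ∈ Ω, |a x| ≤ M
  field_le : ∀ x ∈ Ω, ∑ i, w i x ^ 2 ≤ M ^ 2
  abs_mult_le : ∀ x ∈ Ω, |laplace φ x - 2 * a x| ≤ M
  grad_mult_le : ∀ x ∈ Ω,
    gradDot (fun y => laplace φ y - 2 * a y) (fun y => laplace φ y - 2 * a y) x ≤ M ^ 2
  grad_grad_le : ∀ x ∈ Ω, gradDot (gradDot φ φ) (gradDot φ φ) x ≤ M ^ 2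
  hess : ∀ x ∈ Ω, ∀ ξ : Fin n → ℝ,
    ∑ i, ∑ j, partialDeriv i (partialDeriv j φ) x * ξ i * ξ j =
      a x * ∑ i, ξ i * ξ i + 2 * (∑ i, partialDeriv i φ x * ξ i) * ∑ i, w i x * ξ i
  field_grad : ∀ x ∈ Ω, ∑ i, w i x * partialDeriv i φ x = -a x

/-- The multiplier entering the antisymmetric part of the conjugated Laplacian. -/
def carlemanMult (τ γ : ℝ) (φ a : EuclideanSpace ℝ (Fin n) → ℝ)
    (x : EuclideanSpace ℝ (Fin n)) : ℝ :=
  (τ + γ * φ x) * (laplace φ x - 2 * a x) + γ * gradDot φ φ x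

theorem ContDiff.laplace_sub (hφ : ContDiff ℝ ∞ φ) (ha : ContDiff ℝ ∞ a) :
    ContDiff ℝ ∞ fun y => _root_.laplace φ y - 2 * a y :=
  hφ.laplace.sub (contDiff_const.mul ha)

theorem ContDiff.carlemanMult (hφ : ContDiff ℝ ∞ φ) (ha : ContDiff ℝ ∞ a) :
    ContDiff ℝ ∞ (carlemanMult τ γ φ a) :=
  (hφ.convexSlope.mul (hφ.laplace_sub ha)).add (contDiff_const.mul (hφ.gradDot hφ))

theorem gradDot_carlemanMult (hφ : ContDiff ℝ ∞ φ) (ha : ContDiff ℝ ∞ a) :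
    gradDot (carlemanMult τ γ φ a) v x =
      γ * (laplace φ x - 2 * a x) * gradDot φ v x +
        (τ + γ * φ x) * gradDot (fun y => laplace φ y - 2 * a y) v x +
        γ * gradDot (gradDot φ φ) v x := by
  have h1 : ∀ i, partialDeriv i (carlemanMult τ γ φ a) x =
      γ * (laplace φ x - 2 * a x) * partialDeriv i φ x +
        (τ + γ * φ x) * partialDeriv i (fun y => laplace φ y - 2 * a y) x +
        γ * partialDeriv i (gradDot φ φ) x := by
    intro i
    unfold carlemanMult
    rw [partialDeriv_add (hφ.convexSlope.mul (hφ.laplace_sub ha))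
      (contDiff_const.mul (hφ.gradDot hφ)),
      partialDeriv_mul hφ.convexSlope (hφ.laplace_sub ha), partialDeriv_convexSlope hφ,
      partialDeriv_const_mul (hφ.gradDot hφ)]
    ring
  simp only [gradDot.eq_1 _ v, h1, Finset.mul_sum, ← Finset.sum_add_distrib]
  exact Finset.sum_congr rfl fun i _ => by ring

variable {Ω : Set (EuclideanSpace ℝ (Fin n))} {w : Fin n → EuclideanSpace ℝ (Fin n) → ℝ} {m M : ℝ}

theorem CarlemanBounds.slope_mem (H : CarlemanBounds Ω φ a w m M) (hx : x ∈ Ω) (hγ : 0 < γ)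
    (hτ : 2 * γ * M ≤ τ) : τ / 2 ≤ τ + γ * φ x ∧ τ + γ * φ x ≤ 2 * τ := by
  have h := abs_le.1 (H.abs_weight_le x hx)
  have h1 := mul_le_mul_of_nonneg_left h.1 hγ.le
  have h2 := mul_le_mul_of_nonneg_left h.2 hγ.le
  have h3 : 0 < γ * M := mul_pos hγ (one_pos.trans_le H.one_le)
  constructor <;> linarith

theorem CarlemanBounds.le_param (H : CarlemanBounds Ω φ a w m M) (hγ : 0 < γ)
    (hτ : 2 * γ * M ≤ τ) : γ ≤ τ := by
  have := mul_le_mul_of_nonneg_left H.one_le hγ.le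
  linarith

theorem CarlemanBounds.gradDot_carlemanMult_sq_le (H : CarlemanBounds Ω φ a w m M)
    (hx : x ∈ Ω) (hγ : 0 < γ) (hτ : 2 * γ * M ≤ τ) :
    gradDot (carlemanMult τ γ φ a) v x ^ 2 ≤ (4 * M ^ 2 * τ) ^ 2 * gradDot v v x := by
  have hM := H.one_le
  have hM2 : M ≤ M ^ 2 := by nlinarith
  have hγτ := H.le_param hγ hτ
  obtain ⟨hs, hs'⟩ := H.slope_mem hx hγ hτ
  set g := √(gradDot v v x) with hg
  have hgg : g ^ 2 = gradDot v v x := Real.sq_sqrt (gradDot_self_nonneg v x)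
  have hg0 : 0 ≤ g := Real.sqrt_nonneg _
  have bound : ∀ f : EuclideanSpace ℝ (Fin n) → ℝ, gradDot f f x ≤ M ^ 2 →
      |gradDot f v x| ≤ M * g := by
    intro f hf
    refine abs_le_of_sq_le_sq ?_ (by positivity)
    calc gradDot f v x ^ 2 ≤ gradDot f f x * gradDot v v x := gradDot_sq_le f v x
      _ ≤ M ^ 2 * gradDot v v x := by gcongr; exact gradDot_self_nonneg v x
      _ = (M * g) ^ 2 := by rw [mul_pow, hgg]
  have b1 := bound φ ((H.grad_le x hx).trans hM2)
  have b2 := bound _ (H.grad_mult_le x hx)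
  have b3 := bound _ (H.grad_grad_le x hx)
  rw [gradDot_carlemanMult H.contDiff_weight H.contDiff_factor, ← hgg, ← mul_pow]
  have hτ0 : 0 < τ := hγ.trans_le hγτ
  refine sq_le_sq.2 (le_trans ?_ (le_abs_self _))
  calc _ ≤ |γ * (laplace φ x - 2 * a x) * gradDot φ v x| +
        |(τ + γ * φ x) * gradDot (fun y => laplace φ y - 2 * a y) v x| +
        |γ * gradDot (gradDot φ φ) v x| := abs_add_three _ _ _
    _ = γ * |laplace φ x - 2 * a x| * |gradDot φ v x| +
        (τ + γ * φ x) * |gradDot (fun y => laplace φ y - 2 * a y) v x| +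
        γ * |gradDot (gradDot φ φ) v x| := by
      rw [abs_mul, abs_mul, abs_mul, abs_mul, abs_of_pos hγ,
        abs_of_pos (show 0 < τ + γ * φ x by linarith)]
    _ ≤ τ / 2 * M * (M * g) + 2 * τ * (M * g) + τ / 2 * (M * g) := by
      have : γ ≤ τ / 2 := by nlinarith
      gcongr
      exact H.abs_mult_le x hx
    _ ≤ 4 * M ^ 2 * τ * g := by
      have : M * (τ * g) ≤ M ^ 2 * (τ * g) := by gcongr
      have : 0 ≤ M ^ 2 * (τ * g) := by positivity
      linarith

theorem CarlemanBounds.pointwise_estimate (H : CarlemanBounds Ω φ a w m M)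
    (hx : x ∈ Ω) (hγ : 0 < γ) (hτ : 2 * γ * M ≤ τ) (hu : ContDiff ℝ ∞ u)
    (hv : v = fun y => Real.exp (convexWeight τ γ φ y) * u y) :
    (m ^ 2 / (8 * M) * γ - 100 * M ^ 4) * (τ ^ 2 * v x ^ 2 + gradDot v v x) +
        ∑ i, partialDeriv i (carlemanFlux (convexWeight τ γ φ) (carlemanMult τ γ φ a) v i) x -
        m ^ 2 / (8 * M) * γ * ∑ i, partialDeriv i (fun y => v y * partialDeriv i v y) x ≤
      2 * (Real.exp (convexWeight τ γ φ x) * laplace u x) ^ 2 := by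
  have hφ := H.contDiff_weight
  have hΨ : ContDiff ℝ ∞ (convexWeight τ γ φ) := hφ.convexWeight
  have hβ : ContDiff ℝ ∞ (carlemanMult τ γ φ a) := hφ.carlemanMult H.contDiff_factor
  have hvs : ContDiff ℝ ∞ v := hv ▸ hΨ.exp.mul hu
  have hM := H.one_le
  have hγτ := H.le_param hγ hτ
  obtain ⟨hs, hs'⟩ := H.slope_mem hx hγ hτ
  have hτ0 : 0 < τ := hγ.trans_le hγτ
  have hT := exp_mul_laplace (x := x) hΨ hu
  rw [← hv, ← show v x = Real.exp (convexWeight τ γ φ x) * u x from congrFun hv x] at hT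
  have hessv : hessGrad φ v x =
      a x * gradDot v v x + 2 * gradDot φ v x * ∑ i, w i x * partialDeriv i v x :=
    H.hess x hx fun i => partialDeriv i v x
  have hessφ : hessGrad φ φ x = -(a x * gradDot φ φ x) := by
    have : hessGrad φ φ x =
        a x * gradDot φ φ x + 2 * gradDot φ φ x * ∑ i, w i x * partialDeriv i φ x :=
      H.hess x hx fun i => partialDeriv i φ x
    rw [this, H.field_grad x hx]
    ring
  have hwg : (∑ i, w i x * partialDeriv i v x) ^ 2 ≤ M ^ 2 * gradDot v v x := by
    refine (Finset.sum_mul_sq_le_sq_mul_sq _ _ _).trans ?_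
    have : ∑ i, partialDeriv i v x ^ 2 = gradDot v v x := by simp only [gradDot, sq]
    rw [this]
    exact mul_le_mul_of_nonneg_right (H.field_le x hx) (gradDot_self_nonneg v x)
  have hβM : |carlemanMult τ γ φ a x| ≤ 3 * M * τ := by
    have h1 : 0 < τ + γ * φ x := by linarith
    calc |carlemanMult τ γ φ a x|
        ≤ |(τ + γ * φ x) * (laplace φ x - 2 * a x)| + |γ * gradDot φ φ x| := abs_add_le _ _
      _ = (τ + γ * φ x) * |laplace φ x - 2 * a x| + γ * gradDot φ φ x := by
        rw [abs_mul, abs_of_pos h1, abs_of_nonneg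
          (mul_nonneg hγ.le (gradDot_self_nonneg φ x))]
      _ ≤ 2 * τ * M + τ * M := by
        gcongr
        · exact H.abs_mult_le x hx
        · exact gradDot_self_nonneg φ x
        · exact H.grad_le x hx
      _ = 3 * M * τ := by ring
  have key := carleman_algebraic_estimate (v := v x)
    (A := laplace v x + (τ + γ * φ x) ^ 2 * gradDot φ φ x * v x)
    (B := -2 * (τ + γ * φ x) * gradDot φ v x - carlemanMult τ γ φ a x * v x)
    (T := Real.exp (convexWeight τ γ φ x) * laplace u x)
    H.pos H.le_one hM hγ hγτ hs hs' (H.abs_factor_le x hx) (H.le_grad x hx) (H.grad_le x hx)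
    hwg (H.gradDot_carlemanMult_sq_le (v := v) hx hγ hτ) hβM rfl (by
      rw [hT, gradDot_convexWeight_self hφ, gradDot_convexWeight hφ, laplace_convexWeight hφ,
        carlemanMult]
      ring)
  refine le_trans (le_of_eq ?_) key
  rw [sum_partialDeriv_carlemanFlux hΨ hβ hvs, sum_partialDeriv_mul_partialDeriv hvs,
    gradDot_convexWeight_self hφ, gradDot_convexWeight hφ, laplace_convexWeight hφ,
    hessGrad_convexWeight_self hφ, hessGrad_convexWeight hφ, hessv, hessφ]
  have e : carlemanMult τ γ φ a x - ((τ + γ * φ x) * laplace φ x + γ * gradDot φ φ x) =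
      -2 * (τ + γ * φ x) * a x := by
    rw [carlemanMult]; ring
  rw [e]
  ring

end ConvexifiedWeight

section IntegralEstimate

variable {φ a u v f : EuclideanSpace ℝ (Fin n) → ℝ} {x : EuclideanSpace ℝ (Fin n)}
  {Ω : Set (EuclideanSpace ℝ (Fin n))} {w : Fin n → EuclideanSpace ℝ (Fin n) → ℝ}
  {m M τ γ c : ℝ}

theorem partialDeriv_eventuallyEq_zero (h : f =ᶠ[𝓝 x] 0) (i : Fin n) :
    partialDeriv i f =ᶠ[𝓝 x] 0 := by
  filter_upwards [h.fderiv (𝕜 := ℝ)] with y hy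
  simp [partialDeriv, hy, fderiv_zero]

theorem Continuous.integrable_of_forall_notMem_eq_zero {K : Set (EuclideanSpace ℝ (Fin n))}
    (hf : Continuous f) (hK : IsCompact K) (h : ∀ x ∉ K, f x = 0) : Integrable f :=
  hf.integrable_of_hasCompactSupport (HasCompactSupport.intro hK h)

theorem gradDot_exp_mul_le {Ψ : EuclideanSpace ℝ (Fin n) → ℝ} (hΨ : ContDiff ℝ ∞ Ψ)
    (hu : ContDiff ℝ ∞ u) (hv : v = fun y => Real.exp (Ψ y) * u y) :
    Real.exp (Ψ x) ^ 2 * gradDot u u x ≤ 2 * gradDot v v x + 2 * gradDot Ψ Ψ x * v x ^ 2 := by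
  simp only [gradDot, Finset.mul_sum, Finset.sum_mul, ← Finset.sum_add_distrib]
  refine Finset.sum_le_sum fun i _ => ?_
  have h1 : partialDeriv i v x =
      Real.exp (Ψ x) * partialDeriv i u x + partialDeriv i Ψ x * v x := by
    rw [hv, partialDeriv_exp_mul hΨ hu]
    ring
  rw [h1]
  linarith [sq_nonneg (Real.exp (Ψ x) * partialDeriv i u x + 2 * (partialDeriv i Ψ x * v x))]

/-- The Carleman estimate for the Laplacian of real-valued functions, with a convexified weight. -/
theorem CarlemanBounds.integral_estimate (H : CarlemanBounds Ω φ a w m M) (hγ : 0 < γ)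
    (hτ : 2 * γ * M ≤ τ) (hc : 0 ≤ c) (hcγ : c * (9 * M) ≤ m ^ 2 / (8 * M) * γ - 100 * M ^ 4)
    (hu : ContDiff ℝ ∞ u) (hcs : HasCompactSupport u) (hΩ : tsupport u ⊆ Ω) :
    c * ∫ x, Real.exp (convexWeight τ γ φ x) ^ 2 * (τ ^ 2 * u x ^ 2 + gradDot u u x) ≤
      2 * ∫ x, Real.exp (convexWeight τ γ φ x) ^ 2 * laplace u x ^ 2 := by
  have hφ := H.contDiff_weight
  have hM := H.one_le
  set Ψ := convexWeight τ γ φ with hΨd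
  have hΨ : ContDiff ℝ ∞ Ψ := hφ.convexWeight
  have hβ : ContDiff ℝ ∞ (carlemanMult τ γ φ a) := hφ.carlemanMult H.contDiff_factor
  set v := fun y => Real.exp (Ψ y) * u y with hv
  have hvs : ContDiff ℝ ∞ v := hΨ.exp.mul hu
  set k := m ^ 2 / (8 * M)
  have hu0 : ∀ x ∉ tsupport u, u =ᶠ[𝓝 x] 0 := fun x hx => notMem_tsupport_iff_eventuallyEq.1 hx
  have hv0 : ∀ x ∉ tsupport u, v =ᶠ[𝓝 x] 0 := fun x hx => by
    filter_upwards [hu0 x hx] with y hy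
    simp [hv, hy]
  have hF0 : ∀ i, ∀ x ∉ tsupport u, carlemanFlux Ψ (carlemanMult τ γ φ a) v i =ᶠ[𝓝 x] 0 := by
    intro i x hx
    have : ∀ᶠ y in 𝓝 x, ∀ j, partialDeriv j v y = 0 :=
      Filter.eventually_all.2 fun j => partialDeriv_eventuallyEq_zero (hv0 x hx) j
    filter_upwards [hv0 x hx, this] with y hy hy'
    simp [carlemanFlux, gradDot, hy, hy']
  have hG0 : ∀ i, ∀ x ∉ tsupport u, (fun y => v y * partialDeriv i v y) =ᶠ[𝓝 x] 0 := by
    intro i x hx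
    filter_upwards [hv0 x hx] with y hy
    simp [hy]
  have hFs := hΨ.carlemanFlux hβ hvs
  have hGs := fun i => hvs.mul (hvs.partialDeriv i)
  have div : ∀ F : Fin n → EuclideanSpace ℝ (Fin n) → ℝ, (∀ i, ContDiff ℝ ∞ (F i)) →
      (∀ i, ∀ x ∉ tsupport u, F i =ᶠ[𝓝 x] 0) →
      Integrable (fun x => ∑ i, partialDeriv i (F i) x) ∧
        ∫ x, ∑ i, partialDeriv i (F i) x = 0 := by
    intro F hF h0
    have hi : ∀ i, Integrable (partialDeriv i (F i)) := fun i =>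
      ((hF i).partialDeriv i).continuous.integrable_of_forall_notMem_eq_zero hcs fun x hx =>
        (partialDeriv_eventuallyEq_zero (h0 i x hx) i).eq_of_nhds
    refine ⟨integrable_finsetSum _ fun i _ => hi i, ?_⟩
    rw [integral_finsetSum _ fun i _ => hi i]
    exact Finset.sum_eq_zero fun i _ => integral_partialDeriv_eq_zero (hF i)
      (HasCompactSupport.intro hcs fun x hx => (h0 i x hx).eq_of_nhds)
  obtain ⟨hFi, hF⟩ := div _ hFs hF0
  obtain ⟨hGi, hG⟩ := div _ hGs hG0
  have hgrad0 : ∀ x ∉ tsupport u, gradDot u u x = 0 := fun x hx =>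
    Finset.sum_eq_zero fun i _ => by
      simp [(partialDeriv_eventuallyEq_zero (hu0 x hx) i).eq_of_nhds]
  have hlap0 : ∀ x ∉ tsupport u, laplace u x = 0 := fun x hx =>
    Finset.sum_eq_zero fun i _ => (partialDeriv_eventuallyEq_zero
      (partialDeriv_eventuallyEq_zero (hu0 x hx) i) i).eq_of_nhds
  have hΨc := hΨ.continuous
  have huc := hu.continuous
  have hgc := (hu.gradDot hu).continuous
  have hlc := hu.laplace.continuous
  have i1 : Integrable fun x => Real.exp (Ψ x) ^ 2 * (τ ^ 2 * u x ^ 2 + gradDot u u x) :=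
    Continuous.integrable_of_forall_notMem_eq_zero (by fun_prop) hcs fun x hx => by
      simp [hgrad0 x hx, (hu0 x hx).eq_of_nhds]
  have i2 : Integrable fun x => Real.exp (Ψ x) ^ 2 * laplace u x ^ 2 :=
    Continuous.integrable_of_forall_notMem_eq_zero (by fun_prop) hcs fun x hx => by simp [hlap0 x hx]
  have hle : ∀ x, c * (Real.exp (Ψ x) ^ 2 * (τ ^ 2 * u x ^ 2 + gradDot u u x)) +
      ∑ i, partialDeriv i (carlemanFlux Ψ (carlemanMult τ γ φ a) v i) x -
        k * γ * ∑ i, partialDeriv i (fun y => v y * partialDeriv i v y) x ≤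
      2 * (Real.exp (Ψ x) ^ 2 * laplace u x ^ 2) := by
    intro x
    by_cases hx : x ∈ tsupport u
    · have h1 := H.pointwise_estimate (hΩ hx) hγ hτ hu hv
      have h2 := gradDot_exp_mul_le (x := x) hΨ hu hv
      obtain ⟨hs, hs'⟩ := H.slope_mem (hΩ hx) hγ hτ
      have hτ0 : 0 < τ := hγ.trans_le (H.le_param hγ hτ)
      have h3 : gradDot Ψ Ψ x ≤ 4 * M * τ ^ 2 := by
        rw [gradDot_convexWeight_self hφ]
        calc (τ + γ * φ x) ^ 2 * gradDot φ φ x ≤ (2 * τ) ^ 2 * M := by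
              gcongr
              · exact gradDot_self_nonneg φ x
              · linarith
              · exact H.grad_le x (hΩ hx)
          _ = 4 * M * τ ^ 2 := by ring
      have h4 : v x ^ 2 = Real.exp (Ψ x) ^ 2 * u x ^ 2 := by rw [← mul_pow]
      have hg := gradDot_self_nonneg v x
      have h5 : Real.exp (Ψ x) ^ 2 * (τ ^ 2 * u x ^ 2 + gradDot u u x) ≤
          9 * M * (τ ^ 2 * v x ^ 2 + gradDot v v x) := by
        have h6 : gradDot Ψ Ψ x * v x ^ 2 ≤ 4 * M * τ ^ 2 * v x ^ 2 := by gcongr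
        have h7 : 1 * (τ ^ 2 * v x ^ 2) ≤ M * (τ ^ 2 * v x ^ 2) := by gcongr
        have h8 : 1 * gradDot v v x ≤ M * gradDot v v x := by gcongr
        have h9 : Real.exp (Ψ x) ^ 2 * (τ ^ 2 * u x ^ 2 + gradDot u u x) =
          τ ^ 2 * v x ^ 2 + Real.exp (Ψ x) ^ 2 * gradDot u u x := by rw [h4]; ring
        linarith
      have h10 := mul_le_mul_of_nonneg_left h5 hc
      have h11 := mul_le_mul_of_nonneg_right hcγ
        (add_nonneg (by positivity : 0 ≤ τ ^ 2 * v x ^ 2) hg)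
      linarith
    · have e1 : ∑ i, partialDeriv i (carlemanFlux Ψ (carlemanMult τ γ φ a) v i) x = 0 :=
        Finset.sum_eq_zero fun i _ =>
          (partialDeriv_eventuallyEq_zero (hF0 i x hx) i).eq_of_nhds
      have e2 : ∑ i, partialDeriv i (fun y => v y * partialDeriv i v y) x = 0 :=
        Finset.sum_eq_zero fun i _ =>
          (partialDeriv_eventuallyEq_zero (hG0 i x hx) i).eq_of_nhds
      rw [e1, e2, hgrad0 x hx, hlap0 x hx, (hu0 x hx).eq_of_nhds]
      simp
  have hsum : Integrable fun x =>
      c * (Real.exp (Ψ x) ^ 2 * (τ ^ 2 * u x ^ 2 + gradDot u u x)) +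
        ∑ i, partialDeriv i (carlemanFlux Ψ (carlemanMult τ γ φ a) v i) x :=
    (i1.const_mul c).add hFi
  have hint := integral_mono (hsum.sub (hGi.const_mul (k * γ))) (i2.const_mul 2) hle
  rw [integral_sub' hsum (hGi.const_mul (k * γ)), integral_add (i1.const_mul c) hFi,
    integral_const_mul, integral_const_mul, integral_const_mul, hF, hG] at hint
  simpa using hint

end IntegralEstimate

section ComplexEstimate

variable {φ a : EuclideanSpace ℝ (Fin n) → ℝ} {u : EuclideanSpace ℝ (Fin n) → ℂ}
  {x : EuclideanSpace ℝ (Fin n)} {Ω : Set (EuclideanSpace ℝ (Fin n))}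
  {w : Fin n → EuclideanSpace ℝ (Fin n) → ℝ} {m M : ℝ}

theorem partialDeriv_clm_comp (ℓ : ℂ →L[ℝ] ℝ) (hu : ContDiff ℝ ∞ u) (i : Fin n) :
    partialDeriv i (fun y => ℓ (u y)) x = ℓ (fderiv ℝ u x (EuclideanSpace.single i 1)) := by
  have := (ℓ.hasFDerivAt.comp x (hu.differentiable (by simp) x).hasFDerivAt).fderiv
  simp only [partialDeriv]
  exact congrArg (fun L => L (EuclideanSpace.single i 1)) this

theorem laplace_clm_comp (ℓ : ℂ →L[ℝ] ℝ) (hu : ContDiff ℝ ∞ u) :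
    laplace (fun y => ℓ (u y)) x = ℓ (eLap u x) := by
  simp only [laplace, eLap, map_sum]
  refine Finset.sum_congr rfl fun i _ => ?_
  have h1 : ContDiff ℝ ∞ fun y => fderiv ℝ u y (EuclideanSpace.single i 1) :=
    (hu.fderiv_right (m := ∞) (by simp)).clm_apply contDiff_const
  have h2 : DifferentiableAt ℝ (fderiv ℝ u) x :=
    (hu.fderiv_right (m := ∞) (by simp)).differentiable (by simp) x
  rw [show partialDeriv i (fun y => ℓ (u y)) =
      fun y => ℓ (fderiv ℝ u y (EuclideanSpace.single i 1)) from
    funext fun y => partialDeriv_clm_comp ℓ hu i, partialDeriv_clm_comp ℓ h1,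
    iteratedFDeriv_two_apply, fderiv_clm_apply h2 (by fun_prop)]
  simp

theorem eLap_eq_zero (h : u =ᶠ[𝓝 x] 0) : eLap u x = 0 := by
  simp only [eLap, (h.iteratedFDeriv ℝ 2).eq_of_nhds]
  simp

theorem ContinuousLinearMap.norm_sq_le_sum {F : Type*} [NormedAddCommGroup F] [NormedSpace ℝ F]
    (L : EuclideanSpace ℝ (Fin n) →L[ℝ] F) :
    ‖L‖ ^ 2 ≤ ∑ i, ‖L (EuclideanSpace.single i 1)‖ ^ 2 := by
  have h : ‖L‖ ≤ √(∑ i, ‖L (EuclideanSpace.single i 1)‖ ^ 2) := by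
    refine L.opNorm_le_bound (Real.sqrt_nonneg _) fun v => ?_
    have hv : L v = ∑ i, v i • L (EuclideanSpace.single i 1) := by
      conv_lhs => rw [← (EuclideanSpace.basisFun (Fin n) ℝ).sum_repr v]
      simp
    calc ‖L v‖ ≤ ∑ i, ‖L (EuclideanSpace.single i 1)‖ * ‖v i‖ := by
          rw [hv]
          refine norm_sum_le_of_le _ fun i _ => ?_
          rw [norm_smul, mul_comm]
      _ ≤ _ := by
          rw [EuclideanSpace.norm_eq v]
          exact Real.sum_mul_le_sqrt_mul_sqrt _ _ _
  calc ‖L‖ ^ 2 ≤ √(∑ i, ‖L (EuclideanSpace.single i 1)‖ ^ 2) ^ 2 := by gcongr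
    _ = _ := Real.sq_sqrt (by positivity)

theorem norm_fderiv_sq_le (hu : ContDiff ℝ ∞ u) :
    ‖fderiv ℝ u x‖ ^ 2 ≤ gradDot (fun y => Complex.reCLM (u y)) (fun y => Complex.reCLM (u y)) x +
      gradDot (fun y => Complex.imCLM (u y)) (fun y => Complex.imCLM (u y)) x := by
  refine (ContinuousLinearMap.norm_sq_le_sum _).trans_eq ?_
  simp only [gradDot, ← Finset.sum_add_distrib, partialDeriv_clm_comp _ hu]
  refine Finset.sum_congr rfl fun i _ => ?_
  rw [Complex.sq_norm, Complex.normSq_apply]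
  simp

/-- The Carleman estimate for complex-valued functions, stable under lower order perturbations of
the Laplacian. -/
theorem CarlemanBounds.exists_estimate (H : CarlemanBounds Ω φ a w m M)
    {X : EuclideanSpace ℝ (Fin n) → EuclideanSpace ℝ (Fin n)} (hX : Continuous X)
    {q : EuclideanSpace ℝ (Fin n) → ℂ} (hq : Continuous q) {Q : ℝ}
    (hXQ : ∀ x ∈ Ω, ‖X x‖ ≤ Q) (hqQ : ∀ x ∈ Ω, ‖q x‖ ≤ Q) :
    ∃ τ₀ K : ℝ, 1 ≤ τ₀ ∧ 0 < K ∧ ∀ τ ≥ τ₀, ∀ u : EuclideanSpace ℝ (Fin n) → ℂ,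
      ContDiff ℝ ∞ u → HasCompactSupport u → tsupport u ⊆ Ω →
      ∫ x, Real.exp (τ * φ x) ^ 2 * (τ ^ 2 * ‖u x‖ ^ 2 + ‖fderiv ℝ u x‖ ^ 2) ≤
        K * ∫ x, Real.exp (τ * φ x) ^ 2 *
          ‖eLap u x + fderiv ℝ u x (X x) + q x * u x‖ ^ 2 := by
  have hM := H.one_le
  have hm := H.pos
  have hφ := H.contDiff_weight
  set c := 8 * Q ^ 2 + 1 with hc
  set γ := (c * (9 * M) + 100 * M ^ 4) / (m ^ 2 / (8 * M)) with hγd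
  have hγ : 0 < γ := by positivity
  have hcγ : c * (9 * M) ≤ m ^ 2 / (8 * M) * γ - 100 * M ^ 4 := by
    rw [hγd, mul_div_cancel₀ _ (by positivity)]
    linarith
  refine ⟨max 1 (2 * γ * M), 4 * Real.exp (γ * M ^ 2), le_max_left _ _, by positivity, ?_⟩
  intro τ hτ u hu hcs hΩ
  have hτ1 : 1 ≤ τ := (le_max_left _ _).trans hτ
  have hτ2 : 2 * γ * M ≤ τ := (le_max_right _ _).trans hτ
  set Ψ := convexWeight τ γ φ with hΨd
  have hΨ : Continuous Ψ := hφ.convexWeight.continuous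
  have hφc := hφ.continuous
  have hu0 : ∀ x ∉ tsupport u, u =ᶠ[𝓝 x] 0 := fun x hx => notMem_tsupport_iff_eventuallyEq.1 hx
  have hd0 : ∀ x ∉ tsupport u, fderiv ℝ u x = 0 := fun x hx => by
    rw [(hu0 x hx).fderiv_eq, fderiv_zero]
    rfl
  set r : (ℂ →L[ℝ] ℝ) → EuclideanSpace ℝ (Fin n) → ℝ := fun ℓ y => ℓ (u y) with hr
  have hrs : ∀ ℓ, ContDiff ℝ ∞ (r ℓ) := fun ℓ => ℓ.contDiff.comp hu
  have hr0 : ∀ ℓ, ∀ x ∉ tsupport u, r ℓ =ᶠ[𝓝 x] 0 := fun ℓ x hx => by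
    filter_upwards [hu0 x hx] with y hy
    simp [hr, hy]
  have hrt : ∀ ℓ, tsupport (r ℓ) ⊆ tsupport u := fun ℓ x hx => by
    by_contra h
    exact notMem_tsupport_iff_eventuallyEq.2 (hr0 ℓ x h) hx
  have hrc : ∀ ℓ, HasCompactSupport (r ℓ) := fun ℓ =>
    hcs.of_isClosed_subset (isClosed_tsupport _) (hrt ℓ)
  have hg0 : ∀ ℓ, ∀ x ∉ tsupport u, gradDot (r ℓ) (r ℓ) x = 0 := fun ℓ x hx =>
    Finset.sum_eq_zero fun i _ => by
      simp [(partialDeriv_eventuallyEq_zero (hr0 ℓ x hx) i).eq_of_nhds]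
  have hl0 : ∀ ℓ, ∀ x ∉ tsupport u, laplace (r ℓ) x = 0 := fun ℓ x hx =>
    Finset.sum_eq_zero fun i _ => (partialDeriv_eventuallyEq_zero
      (partialDeriv_eventuallyEq_zero (hr0 ℓ x hx) i) i).eq_of_nhds
  have hrcont : ∀ ℓ, Continuous (r ℓ) := fun ℓ => (hrs ℓ).continuous
  have hgc : ∀ ℓ, Continuous (gradDot (r ℓ) (r ℓ)) := fun ℓ =>
    ((hrs ℓ).gradDot (hrs ℓ)).continuous
  have hlc : ∀ ℓ, Continuous (laplace (r ℓ)) := fun ℓ => (hrs ℓ).laplace.continuous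
  have hu0' : ∀ x ∉ tsupport u, u x = 0 := fun x hx => (hu0 x hx).eq_of_nhds
  have hlap0 : ∀ x ∉ tsupport u, eLap u x = 0 := fun x hx => eLap_eq_zero (hu0 x hx)
  have huc := hu.continuous
  have hdc : Continuous (fderiv ℝ u) := hu.continuous_fderiv (by simp)
  have hec : Continuous (eLap u) := by
    unfold eLap
    refine continuous_finsetSum _ fun i _ => ?_
    have := hu.continuous_iteratedFDeriv (m := 2)
      (by simpa using (WithTop.coe_le_coe.2 le_top : ((2 : ℕ∞) : WithTop ℕ∞) ≤ ∞))
    fun_prop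
  have i1 : ∀ ℓ, Integrable fun x => Real.exp (Ψ x) ^ 2 *
      (τ ^ 2 * r ℓ x ^ 2 + gradDot (r ℓ) (r ℓ) x) := fun ℓ =>
    have := hrcont ℓ
    have := hgc ℓ
    Continuous.integrable_of_forall_notMem_eq_zero (by fun_prop) hcs fun x hx => by
      simp [hg0 ℓ x hx, (hr0 ℓ x hx).eq_of_nhds]
  have i2 : ∀ ℓ, Integrable fun x => Real.exp (Ψ x) ^ 2 * laplace (r ℓ) x ^ 2 := fun ℓ =>
    have := hlc ℓ
    Continuous.integrable_of_forall_notMem_eq_zero (by fun_prop) hcs fun x hx => by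
      simp [hl0 ℓ x hx]
  set P := fun x => ‖eLap u x + fderiv ℝ u x (X x) + q x * u x‖ ^ 2 with hP
  have hPc : Continuous P := by fun_prop
  have hP0 : ∀ x ∉ tsupport u, P x = 0 := fun x hx => by
    simp [hP, hlap0 x hx, hd0 x hx, hu0' x hx]
  have i3 : Integrable fun x => Real.exp (Ψ x) ^ 2 * P x :=
    Continuous.integrable_of_forall_notMem_eq_zero (by fun_prop) hcs fun x hx => by
      simp [hP0 x hx]
  have i4 : Integrable fun x => Real.exp (τ * φ x) ^ 2 * P x :=
    Continuous.integrable_of_forall_notMem_eq_zero (by fun_prop) hcs fun x hx => by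
      simp [hP0 x hx]
  have i5 : Integrable fun x => Real.exp (τ * φ x) ^ 2 *
      (τ ^ 2 * ‖u x‖ ^ 2 + ‖fderiv ℝ u x‖ ^ 2) :=
    Continuous.integrable_of_forall_notMem_eq_zero (by fun_prop) hcs fun x hx => by
      simp [hu0' x hx, hd0 x hx]
  have e1 := fun ℓ => H.integral_estimate hγ hτ2 (by positivity : 0 ≤ c) hcγ (hrs ℓ) (hrc ℓ)
    ((hrt ℓ).trans hΩ)
  have hnorm : ∀ z : ℂ, ‖z‖ ^ 2 = Complex.reCLM z ^ 2 + Complex.imCLM z ^ 2 := fun z => by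
    rw [Complex.sq_norm, Complex.normSq_apply]
    simp [pow_two]
  set J := fun x => Real.exp (Ψ x) ^ 2 * (τ ^ 2 * r Complex.reCLM x ^ 2 +
      gradDot (r Complex.reCLM) (r Complex.reCLM) x) + Real.exp (Ψ x) ^ 2 *
      (τ ^ 2 * r Complex.imCLM x ^ 2 + gradDot (r Complex.imCLM) (r Complex.imCLM) x) with hJ
  have iJ : Integrable J := (i1 _).add (i1 _)
  have hd : ∀ x, Real.exp (Ψ x) ^ 2 * (τ ^ 2 * ‖u x‖ ^ 2 + ‖fderiv ℝ u x‖ ^ 2) ≤ J x := by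
    intro x
    calc _ ≤ Real.exp (Ψ x) ^ 2 * (τ ^ 2 * ‖u x‖ ^ 2 +
          (gradDot (r Complex.reCLM) (r Complex.reCLM) x +
            gradDot (r Complex.imCLM) (r Complex.imCLM) x)) := by
          gcongr
          exact norm_fderiv_sq_le hu
      _ = J x := by
          rw [hnorm]
          ring
  have hpt : ∀ x, Real.exp (Ψ x) ^ 2 * laplace (r Complex.reCLM) x ^ 2 +
      Real.exp (Ψ x) ^ 2 * laplace (r Complex.imCLM) x ^ 2 ≤
      2 * (Real.exp (Ψ x) ^ 2 * P x) + 4 * Q ^ 2 * J x := by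
    intro x
    by_cases hx : x ∈ tsupport u
    · have h1 : ‖eLap u x‖ ≤
          ‖eLap u x + fderiv ℝ u x (X x) + q x * u x‖ + Q * ‖fderiv ℝ u x‖ + Q * ‖u x‖ := by
        have h2 : ‖fderiv ℝ u x (X x)‖ ≤ Q * ‖fderiv ℝ u x‖ := by
          rw [mul_comm]
          exact (fderiv ℝ u x).le_opNorm_of_le (hXQ x (hΩ hx))
        have h3 : ‖q x * u x‖ ≤ Q * ‖u x‖ := by
          rw [norm_mul]
          gcongr
          exact hqQ x (hΩ hx)
        calc ‖eLap u x‖ = ‖eLap u x + fderiv ℝ u x (X x) + q x * u x - fderiv ℝ u x (X x) -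
              q x * u x‖ := by congr 1; ring
          _ ≤ _ := (norm_sub_le _ _).trans (add_le_add ((norm_sub_le _ _).trans
              (add_le_add le_rfl h2)) h3)
      have h2 : ‖eLap u x‖ ^ 2 ≤ 2 * P x + 4 * Q ^ 2 * (‖u x‖ ^ 2 + ‖fderiv ℝ u x‖ ^ 2) := by
        refine (pow_le_pow_left₀ (norm_nonneg _) h1 2).trans ?_
        simp only [hP]
        nlinarith [sq_nonneg (‖eLap u x + fderiv ℝ u x (X x) + q x * u x‖ -
          (Q * ‖fderiv ℝ u x‖ + Q * ‖u x‖)), sq_nonneg (Q * ‖fderiv ℝ u x‖ - Q * ‖u x‖)]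
      have h3 : ‖u x‖ ^ 2 ≤ τ ^ 2 * ‖u x‖ ^ 2 :=
        le_mul_of_one_le_left (by positivity) (one_le_pow₀ hτ1)
      calc _ = Real.exp (Ψ x) ^ 2 * ‖eLap u x‖ ^ 2 := by
            rw [hnorm, laplace_clm_comp _ hu, laplace_clm_comp _ hu]
            ring
        _ ≤ Real.exp (Ψ x) ^ 2 * (2 * P x + 4 * Q ^ 2 *
              (τ ^ 2 * ‖u x‖ ^ 2 + ‖fderiv ℝ u x‖ ^ 2)) := by
            gcongr
            refine h2.trans ?_
            gcongr
        _ = 2 * (Real.exp (Ψ x) ^ 2 * P x) + 4 * Q ^ 2 *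
              (Real.exp (Ψ x) ^ 2 * (τ ^ 2 * ‖u x‖ ^ 2 + ‖fderiv ℝ u x‖ ^ 2)) := by ring
        _ ≤ _ := by
            gcongr
            exact hd x
    · simp [hJ, hl0 _ x hx, hP0 x hx, hg0 _ x hx, (hr0 _ x hx).eq_of_nhds]
  have hJint : ∫ x, J x ≤ 4 * ∫ x, Real.exp (Ψ x) ^ 2 * P x := by
    have h1 := integral_mono ((i2 Complex.reCLM).add (i2 Complex.imCLM))
      ((i3.const_mul 2).add (iJ.const_mul (4 * Q ^ 2))) hpt
    rw [integral_add' (i2 _) (i2 _), integral_add' (i3.const_mul 2) (iJ.const_mul _),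
      integral_const_mul, integral_const_mul] at h1
    have h2 : ∫ x, J x = _ := integral_add (i1 Complex.reCLM) (i1 Complex.imCLM)
    have h3 := e1 Complex.reCLM
    have h4 := e1 Complex.imCLM
    have h5 : c * ∫ x, J x ≤ 4 * (∫ x, Real.exp (Ψ x) ^ 2 * P x) + 8 * Q ^ 2 * ∫ x, J x := by
      linarith [congrArg (fun t => c * t) h2]
    rw [hc] at h5
    linarith
  have hsq : ∀ x, Real.exp (Ψ x) ^ 2 = Real.exp (γ * φ x ^ 2) * Real.exp (τ * φ x) ^ 2 := by
    intro x
    rw [← Real.exp_nat_mul, ← Real.exp_nat_mul, ← Real.exp_add, hΨd, convexWeight]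
    congr 1
    push_cast
    ring
  calc _ ≤ ∫ x, J x := integral_mono i5 iJ fun x => by
        refine le_trans ?_ (hd x)
        dsimp only
        gcongr
        exact le_add_of_nonneg_right (mul_nonneg (by positivity) (mul_self_nonneg _))
    _ ≤ 4 * ∫ x, Real.exp (Ψ x) ^ 2 * P x := hJint
    _ ≤ 4 * ∫ x, Real.exp (γ * M ^ 2) * (Real.exp (τ * φ x) ^ 2 * P x) := by
        refine mul_le_mul_of_nonneg_left (integral_mono i3 (i4.const_mul _) fun x => ?_) (by simp)
        dsimp only
        by_cases hx : x ∈ tsupport u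
        · have h1 : φ x ^ 2 ≤ M ^ 2 := sq_le_sq' (abs_le.1 (H.abs_weight_le x (hΩ hx))).1
            (abs_le.1 (H.abs_weight_le x (hΩ hx))).2
          have h2 : 0 ≤ P x := by positivity
          rw [hsq, mul_assoc]
          gcongr
        · simp [hP0 x hx]
    _ = _ := by rw [integral_const_mul, mul_assoc]

end ComplexEstimate

/-- A bilinear form whose quadratic form on the sphere of radius `‖N‖` orthogonal to `N` is the
constant `-B N N` is, up to a multiple of the metric, a symmetric product with `N`. -/
theorem apply_self_eq_of_forall_orthogonal {E : Type*} [NormedAddCommGroup E]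
    [InnerProductSpace ℝ E] (B : E →L[ℝ] E →L[ℝ] ℝ) (hB : ∀ x y, B x y = B y x) {N : E}
    (hN : N ≠ 0) (h : ∀ X, ‖X‖ = ‖N‖ → ⟪X, N⟫ = 0 → B X X + B N N = 0) (ξ : E) :
    B ξ ξ = -(B N N / ‖N‖ ^ 2) * ‖ξ‖ ^ 2 + 2 * ⟪N, ξ⟫ * (B ξ N / ‖N‖ ^ 2) := by
  have hN' : ‖N‖ ≠ 0 := norm_ne_zero_iff.2 hN
  set t := ⟪N, ξ⟫ / ‖N‖ ^ 2 with ht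
  set Y := ξ - t • N with hY
  have hYN : ⟪Y, N⟫ = 0 := by
    rw [hY, inner_sub_left, real_inner_smul_left, real_inner_self_eq_norm_sq, ht,
      real_inner_comm, div_mul_cancel₀ _ (by positivity), sub_self]
  have hYY : B Y Y = -(B N N / ‖N‖ ^ 2) * ‖Y‖ ^ 2 := by
    by_cases hY0 : Y = 0
    · simp [hY0]
    · have hY' : ‖Y‖ ≠ 0 := norm_ne_zero_iff.2 hY0
      have := h ((‖N‖ / ‖Y‖) • Y) (by
        rw [norm_smul, Real.norm_of_nonneg (by positivity), div_mul_cancel₀ _ hY'])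
        (by rw [real_inner_smul_left, hYN, mul_zero])
      simp only [map_smul, smul_apply, smul_eq_mul] at this
      field_simp at this ⊢
      linarith
  have hnorm : ‖Y‖ ^ 2 = ‖ξ‖ ^ 2 - t ^ 2 * ‖N‖ ^ 2 := by
    rw [hY, norm_sub_sq_real, real_inner_smul_right, real_inner_comm, norm_smul, mul_pow,
      Real.norm_eq_abs, sq_abs, ht]
    field_simp
    ring
  have hexp : B Y Y = B ξ ξ - 2 * t * B ξ N + t ^ 2 * B N N := by
    rw [hY]
    simp only [map_sub, map_smul, sub_apply, smul_apply,
      smul_eq_mul, hB N ξ]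
    ring
  rw [hexp, hnorm] at hYY
  rw [show 2 * ⟪N, ξ⟫ * (B ξ N / ‖N‖ ^ 2) = 2 * t * B ξ N by rw [ht]; ring]
  field_simp at hYY ⊢
  linarith

section LimitingCarlemanWeight

variable {φ ψ : EuclideanSpace ℝ (Fin n) → ℝ} {x : EuclideanSpace ℝ (Fin n)}
  {U Ω : Set (EuclideanSpace ℝ (Fin n))}

theorem ContDiff.hessGrad (hψ : ContDiff ℝ ∞ ψ) : ContDiff ℝ ∞ (hessGrad ψ ψ) :=
  ContDiff.sum fun i _ => ContDiff.sum fun j _ =>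
    (((hψ.partialDeriv j).partialDeriv i).mul (hψ.partialDeriv i)).mul (hψ.partialDeriv j)

theorem fderiv_fderiv_apply_eq_sum (hψ : ContDiff ℝ ∞ ψ) (X Y : EuclideanSpace ℝ (Fin n)) :
    fderiv ℝ (fderiv ℝ ψ) x X Y =
      ∑ i, ∑ j, partialDeriv i (partialDeriv j ψ) x * X i * Y j := by
  conv_lhs => rw [← (EuclideanSpace.basisFun (Fin n) ℝ).sum_repr X,
    ← (EuclideanSpace.basisFun (Fin n) ℝ).sum_repr Y]
  simp only [map_sum, map_smul, smul_apply, sum_apply, smul_eq_mul,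
    EuclideanSpace.basisFun_apply, EuclideanSpace.basisFun_repr, Finset.mul_sum]
  rw [Finset.sum_comm]
  refine Finset.sum_congr rfl fun i _ => Finset.sum_congr rfl fun j _ => ?_
  rw [partialDeriv_partialDeriv_eq hψ]
  ring

theorem gradient_apply (f : EuclideanSpace ℝ (Fin n) → ℝ) (i : Fin n) :
    gradient f x i = partialDeriv i f x := by
  have h := InnerProductSpace.toDual_symm_apply (𝕜 := ℝ) (x := EuclideanSpace.single i (1 : ℝ))
    (y := fderiv ℝ f x)
  rw [partialDeriv, ← h, gradient, EuclideanSpace.inner_single_right]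
  simp

theorem norm_gradient_sq (f : EuclideanSpace ℝ (Fin n) → ℝ) :
    ‖gradient f x‖ ^ 2 = gradDot f f x := by
  rw [EuclideanSpace.norm_sq_eq]
  simp [gradient_apply, gradDot, pow_two]

/-- A limiting Carleman weight extends from a bounded set to a global function satisfying uniform
bounds, and its Hessian decomposes there. -/
theorem IsLCW.exists_carlemanBounds (hU : IsOpen U) (hΩ : Bornology.IsBounded Ω)
    (hΩU : closure Ω ⊆ U) (hφ : ContDiffOn ℝ ∞ φ U) (h : IsLCW U φ) :
    ∃ (ψ a : EuclideanSpace ℝ (Fin n) → ℝ) (w : Fin n → EuclideanSpace ℝ (Fin n) → ℝ) (m M : ℝ),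
      CarlemanBounds Ω ψ a w m M ∧ ∀ᶠ x in 𝓝ˢ (closure Ω), ψ x = φ x := by
  obtain ⟨ψ, hψ, hψφ⟩ := hφ.exists_contDiff_eq_nhdsSet isClosed_closure hU hΩU
  have hev := eventually_nhdsSet_iff_forall.1 hψφ
  have hgrad : ∀ x ∈ closure Ω, gradient φ x = gradient ψ x := fun x hx =>
    congrArg _ (Filter.EventuallyEq.fderiv_eq (hev x hx)).symm
  have hHess : ∀ x ∈ closure Ω, ∀ X, Hess φ x X X = fderiv ℝ (fderiv ℝ ψ) x X X := by
    intro x hx X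
    have h1 : iteratedFDeriv ℝ 2 ψ x = iteratedFDeriv ℝ 2 φ x :=
      (Filter.EventuallyEq.iteratedFDeriv ℝ (hev x hx) 2).eq_of_nhds
    rw [Hess, ← h1, iteratedFDeriv_two_apply]
    simp
  have hψ0 : ∀ x ∈ closure Ω, gradient ψ x ≠ 0 := fun x hx =>
    hgrad x hx ▸ h.1 x (hΩU hx)
  have hg0 : ∀ x ∈ closure Ω, gradDot ψ ψ x ≠ 0 := fun x hx => by
    rw [← norm_gradient_sq]
    exact pow_ne_zero _ (norm_ne_zero_iff.2 (hψ0 x hx))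
  have hgs := hψ.gradDot hψ
  obtain ⟨a, ha, haψ⟩ := ContDiffOn.exists_contDiff_eq_nhdsSet
    (f := fun x => -(hessGrad ψ ψ x / gradDot ψ ψ x)) (isClosed_closure (s := Ω))
    (isOpen_ne_fun hgs.continuous continuous_const) (fun x hx => hg0 x hx)
    ((hψ.hessGrad.contDiffOn.div hgs.contDiffOn fun x hx => hx).neg)
  replace haψ : ∀ x ∈ closure Ω, a x = -(hessGrad ψ ψ x / gradDot ψ ψ x) := fun x hx =>
    (eventually_nhdsSet_iff_forall.1 haψ x hx).self_of_nhds
  set w : Fin n → EuclideanSpace ℝ (Fin n) → ℝ := fun i x =>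
    (∑ j, partialDeriv i (partialDeriv j ψ) x * partialDeriv j ψ x) / gradDot ψ ψ x with hw
  have hBN : ∀ x, fderiv ℝ (fderiv ℝ ψ) x (gradient ψ x) (gradient ψ x) = hessGrad ψ ψ x :=
    fun x => by simp [fderiv_fderiv_apply_eq_sum hψ, hessGrad, gradient_apply]
  have hwξ : ∀ x, ∀ ξ : EuclideanSpace ℝ (Fin n), ∑ i, w i x * ξ i =
      fderiv ℝ (fderiv ℝ ψ) x ξ (gradient ψ x) / gradDot ψ ψ x := by
    intro x ξ
    simp only [fderiv_fderiv_apply_eq_sum hψ, hw, Finset.sum_div, Finset.sum_mul, gradient_apply]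
    refine Finset.sum_congr rfl fun i _ => Finset.sum_congr rfl fun j _ => ?_
    ring
  set b := fun y => laplace ψ y - 2 * a y with hb
  have hbs : ContDiff ℝ ∞ b := hψ.laplace_sub ha
  have hwc : ∀ i, ContinuousOn (w i) (closure Ω) := fun i =>
    ContinuousOn.div (continuous_finsetSum _ fun j _ =>
      ((hψ.partialDeriv j).partialDeriv i).continuous.mul
        (hψ.partialDeriv j).continuous).continuousOn hgs.continuous.continuousOn hg0
  have hgi : ContinuousOn (fun x => (gradDot ψ ψ x)⁻¹) (closure Ω) :=
    hgs.continuous.continuousOn.inv₀ hg0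
  have c1 := hψ.continuous
  have c2 := hgs.continuous
  have c3 := ha.continuous
  have c4 := hbs.continuous
  have c5 := (hbs.gradDot hbs).continuous
  have c6 := (hgs.gradDot hgs).continuous
  obtain ⟨C, hC⟩ := (Metric.isCompact_of_isClosed_isBounded isClosed_closure
    hΩ.closure).exists_bound_of_continuousOn (f := fun x => |ψ x| + gradDot ψ ψ x +
      (gradDot ψ ψ x)⁻¹ + |a x| + (∑ i, w i x ^ 2) + |b x| + gradDot b b x +
      gradDot (gradDot ψ ψ) (gradDot ψ ψ) x) (by fun_prop)
  set M := max 1 C with hM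
  have hM1 : 1 ≤ M := le_max_left _ _
  have hM2 : M ≤ M ^ 2 := le_self_pow₀ hM1 two_ne_zero
  have bound : ∀ x ∈ Ω, |ψ x| ≤ M ∧ gradDot ψ ψ x ≤ M ∧ (gradDot ψ ψ x)⁻¹ ≤ M ∧ |a x| ≤ M ∧
      ∑ i, w i x ^ 2 ≤ M ∧ |b x| ≤ M ∧ gradDot b b x ≤ M ∧
      gradDot (gradDot ψ ψ) (gradDot ψ ψ) x ≤ M := by
    intro x hx
    have h1 := (le_abs_self _).trans ((hC x (subset_closure hx)).trans (le_max_right 1 C))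
    rw [← hM] at h1
    have h2 := gradDot_self_nonneg ψ x
    have h3 := inv_nonneg.2 h2
    have h4 := gradDot_self_nonneg b x
    have h5 := gradDot_self_nonneg (gradDot ψ ψ) x
    have h6 : 0 ≤ ∑ i, w i x ^ 2 := by positivity
    have h7 := abs_nonneg (ψ x)
    have h8 := abs_nonneg (a x)
    have h9 := abs_nonneg (b x)
    refine ⟨?_, ?_, ?_, ?_, ?_, ?_, ?_, ?_⟩ <;> linarith
  refine ⟨ψ, a, w, M⁻¹, M, ?_, hψφ⟩
  exact {
    contDiff_weight := hψ
    contDiff_factor := ha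
    pos := by positivity
    le_one := inv_le_one_of_one_le₀ hM1
    one_le := hM1
    abs_weight_le := fun x hx => (bound x hx).1
    le_grad := fun x hx => inv_le_of_inv_le₀
      ((gradDot_self_nonneg ψ x).lt_of_ne' (hg0 x (subset_closure hx))) (bound x hx).2.2.1
    grad_le := fun x hx => (bound x hx).2.1
    abs_factor_le := fun x hx => (bound x hx).2.2.2.1
    field_le := fun x hx => (bound x hx).2.2.2.2.1.trans hM2
    abs_mult_le := fun x hx => (bound x hx).2.2.2.2.2.1
    grad_mult_le := fun x hx => (bound x hx).2.2.2.2.2.2.1.trans hM2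
    grad_grad_le := fun x hx => (bound x hx).2.2.2.2.2.2.2.trans hM2
    hess := fun x hx ξ => by
      have hx' := subset_closure hx
      have h1 := apply_self_eq_of_forall_orthogonal (fderiv ℝ (fderiv ℝ ψ) x)
        (hψ.contDiffAt.isSymmSndFDerivAt
          (by simpa using (WithTop.coe_le_coe.2 le_top : ((2 : ℕ∞) : WithTop ℕ∞) ≤ ∞)))
        (hψ0 x hx') (fun Y hY hY' => by
          rw [← hgrad x hx'] at hY hY' ⊢
          rw [← hHess x hx', ← hHess x hx']
          exact h.2 x (hΩU hx') Y hY hY') (WithLp.toLp 2 ξ)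
      rw [hBN, norm_gradient_sq, ← hwξ, ← haψ x hx', fderiv_fderiv_apply_eq_sum hψ,
        EuclideanSpace.norm_sq_eq,
        PiLp.inner_apply] at h1
      simpa [gradient_apply, pow_two, mul_comm] using h1
    field_grad := fun x hx => by
      have h1 := hwξ x (gradient ψ x)
      simp only [gradient_apply] at h1
      rw [h1, hBN, haψ x (subset_closure hx), neg_neg] }

end LimitingCarlemanWeight

section L2Bounds

variable {ψ : EuclideanSpace ℝ (Fin n) → ℝ} {u : EuclideanSpace ℝ (Fin n) → ℂ}
  {x : EuclideanSpace ℝ (Fin n)} {Ω : Set (EuclideanSpace ℝ (Fin n))}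

theorem norm_fderiv_exp_smul_sq_le (hψ : ContDiff ℝ ∞ ψ) (hu : ContDiff ℝ ∞ u) (τ : ℝ) :
    ‖fderiv ℝ (fun y => Real.exp (τ * ψ y) • u y) x‖ ^ 2 ≤
      2 * Real.exp (τ * ψ x) ^ 2 *
        (‖fderiv ℝ u x‖ ^ 2 + gradDot ψ ψ x * (τ ^ 2 * ‖u x‖ ^ 2)) := by
  have hd := hψ.differentiableAt_real (x := x)
  have h1 : fderiv ℝ (fun y => Real.exp (τ * ψ y) • u y) x =
      Real.exp (τ * ψ x) • (fderiv ℝ u x + (τ • fderiv ℝ ψ x).smulRight (u x)) := by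
    rw [fderiv_fun_smul (hd.const_mul τ).exp (hu.differentiable (by simp) x),
      fderiv_exp (hd.const_mul τ), fderiv_const_mul hd, smul_add]
    congr 1
    ext
    simp [mul_assoc]
  have h2 : ‖fderiv ℝ ψ x‖ ^ 2 ≤ gradDot ψ ψ x := by
    refine (ContinuousLinearMap.norm_sq_le_sum _).trans_eq ?_
    simp [gradDot, partialDeriv, pow_two]
  have h3 : ‖(τ • fderiv ℝ ψ x).smulRight (u x)‖ ^ 2 ≤ gradDot ψ ψ x * (τ ^ 2 * ‖u x‖ ^ 2) := by
    rw [ContinuousLinearMap.norm_smulRight_apply, norm_smul, mul_pow, mul_pow, Real.norm_eq_abs,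
      sq_abs]
    calc _ = ‖fderiv ℝ ψ x‖ ^ 2 * (τ ^ 2 * ‖u x‖ ^ 2) := by ring
      _ ≤ _ := by gcongr
  rw [h1, norm_smul, mul_pow, Real.norm_of_nonneg (Real.exp_pos _).le, mul_comm 2, mul_assoc]
  gcongr
  refine (pow_le_pow_left₀ (norm_nonneg _) (norm_add_le _ _) 2).trans (add_sq_le.trans ?_)
  gcongr

theorem L2norm_eq_sqrt (g : EuclideanSpace ℝ (Fin n) → ℝ) :
    L2norm Ω g = √(∫ x in Ω, g x ^ 2) := by
  rw [L2norm, Real.sqrt_eq_rpow]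

theorem L2norm_le_mul_sqrt_integral (hΩ : MeasurableSet Ω) {g F : EuclideanSpace ℝ (Fin n) → ℝ}
    {c : ℝ} (hc : 0 ≤ c) (hF : Integrable F) (hF0 : ∀ x, 0 ≤ F x)
    (h : ∀ x ∈ Ω, g x ^ 2 ≤ c ^ 2 * F x) : L2norm Ω g ≤ c * √(∫ x, F x) := by
  rw [L2norm_eq_sqrt]
  refine Real.sqrt_le_iff.2 ⟨by positivity, ?_⟩
  rw [mul_pow, Real.sq_sqrt (integral_nonneg hF0), ← integral_const_mul]
  calc ∫ x in Ω, g x ^ 2 ≤ ∫ x in Ω, c ^ 2 * F x :=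
        integral_mono_of_nonneg (ae_of_all _ fun x => sq_nonneg _)
          (hF.const_mul _).integrableOn (ae_restrict_of_forall_mem hΩ h)
    _ ≤ ∫ x, c ^ 2 * F x := setIntegral_le_integral (hF.const_mul _)
        (ae_of_all _ fun x => mul_nonneg (sq_nonneg _) (hF0 x))

end L2Bounds

theorem statement16 {n : ℕ} (hn : 2 ≤ n) (U Ω : Set (EuclideanSpace ℝ (Fin n)))
    (hU : IsOpen U) (hΩopen : IsOpen Ω) (hΩbd : Bornology.IsBounded Ω)
    (hΩU : closure Ω ⊆ U)
    (φ : EuclideanSpace ℝ (Fin n) → ℝ) (hφ : ContDiffOn ℝ (⊤ : ℕ∞) φ U)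
    (hlcw : IsLCW U φ)
    (X : EuclideanSpace ℝ (Fin n) → EuclideanSpace ℝ (Fin n))
    (hX : ContDiffOn ℝ (⊤ : ℕ∞) X U)
    (q : EuclideanSpace ℝ (Fin n) → ℂ) (hq : ContDiffOn ℝ (⊤ : ℕ∞) q U) :
    ∃ C : ℝ, 0 < C ∧ ∃ h₀ : ℝ, h₀ ∈ Set.Ioc (0 : ℝ) 1 ∧
      ∀ h ∈ Set.Ioc (0 : ℝ) h₀, ∀ u : EuclideanSpace ℝ (Fin n) → ℂ,
        ContDiff ℝ (⊤ : ℕ∞) u → HasCompactSupport u → tsupport u ⊆ Ω →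
        L2norm Ω (fun x => ‖Real.exp (φ x / h) • u x‖) +
          L2norm Ω (fun x => ‖h • fderiv ℝ (fun y => Real.exp (φ y / h) • u y) x‖) ≤
        C * h *
          L2norm Ω (fun x =>
            ‖Real.exp (φ x / h) • (eLap u x + fderiv ℝ u x (X x) + q x * u x)‖) := by
  obtain ⟨ψ, a, w, m, M, H, hψφ⟩ := hlcw.exists_carlemanBounds hU hΩbd hΩU hφ
  obtain ⟨Y, hY, hYX⟩ := hX.exists_contDiff_eq_nhdsSet isClosed_closure hU hΩU
  obtain ⟨p, hp, hpq⟩ := hq.exists_contDiff_eq_nhdsSet isClosed_closure hU hΩU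
  rw [eventually_nhdsSet_iff_forall] at hψφ hYX hpq
  have hK : IsCompact (closure Ω) :=
    Metric.isCompact_of_isClosed_isBounded isClosed_closure hΩbd.closure
  obtain ⟨Q₁, hQ₁⟩ := hK.exists_bound_of_continuousOn hY.continuous.continuousOn
  obtain ⟨Q₂, hQ₂⟩ := hK.exists_bound_of_continuousOn hp.continuous.continuousOn
  obtain ⟨τ₀, K, hτ₀, hK0, est⟩ := H.exists_estimate hY.continuous hp.continuous
    (Q := max Q₁ Q₂) (fun x hx => (hQ₁ x (subset_closure hx)).trans (le_max_left _ _))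
    (fun x hx => (hQ₂ x (subset_closure hx)).trans (le_max_right _ _))
  have hψ := H.contDiff_weight
  have hM := H.one_le
  refine ⟨(1 + √(2 * M)) * √K, by positivity, τ₀⁻¹,
    ⟨by positivity, inv_le_one_of_one_le₀ hτ₀⟩, ?_⟩
  rintro h ⟨h0, hh⟩ u hu hcs hsupp
  have hτ : τ₀ ≤ h⁻¹ := le_inv_of_le_inv₀ h0 hh
  set τ := h⁻¹ with hτd
  have hhτ : h * τ = 1 := mul_inv_cancel₀ h0.ne'
  have hexp : ∀ x, Real.exp (ψ x / h) = Real.exp (τ * ψ x) := fun x => by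
    rw [div_eq_inv_mul]
  have hu0 : ∀ x ∉ tsupport u, u =ᶠ[𝓝 x] 0 := fun x hx => notMem_tsupport_iff_eventuallyEq.1 hx
  have hd0 : ∀ x ∉ tsupport u, fderiv ℝ u x = 0 := fun x hx => by
    rw [(hu0 x hx).fderiv_eq, fderiv_zero]
    rfl
  have hψc := hψ.continuous
  have huc := hu.continuous
  have hdc : Continuous (fderiv ℝ u) := hu.continuous_fderiv (by simp)
  set A := fun x => Real.exp (τ * ψ x) ^ 2 * (τ ^ 2 * ‖u x‖ ^ 2 + ‖fderiv ℝ u x‖ ^ 2) with hA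
  have hA0 : ∀ x, 0 ≤ A x := fun x => by positivity
  have iA : Integrable A :=
    Continuous.integrable_of_forall_notMem_eq_zero (by fun_prop) hcs fun x hx => by
      simp [hA, (hu0 x hx).eq_of_nhds, hd0 x hx]
  have hφψ : ∀ x ∈ Ω, φ =ᶠ[𝓝 x] ψ := fun x hx =>
    Filter.EventuallyEq.symm (hψφ x (subset_closure hx))
  have h1 : L2norm Ω (fun x => ‖Real.exp (φ x / h) • u x‖) ≤ h * √(∫ x, A x) := by
    refine L2norm_le_mul_sqrt_integral hΩopen.measurableSet h0.le iA hA0 fun x hx => ?_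
    rw [(hφψ x hx).eq_of_nhds, hexp, norm_smul, Real.norm_of_nonneg (Real.exp_pos _).le, mul_pow]
    calc _ = Real.exp (τ * ψ x) ^ 2 * ((h * τ) ^ 2 * ‖u x‖ ^ 2) := by rw [hhτ]; ring
      _ ≤ Real.exp (τ * ψ x) ^ 2 * ((h * τ) ^ 2 * ‖u x‖ ^ 2 + h ^ 2 * ‖fderiv ℝ u x‖ ^ 2) := by
          gcongr
          exact le_add_of_nonneg_right (by positivity)
      _ = h ^ 2 * A x := by rw [hA]; ring
  have h2 : L2norm Ω (fun x => ‖h • fderiv ℝ (fun y => Real.exp (φ y / h) • u y) x‖) ≤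
      h * √(2 * M) * √(∫ x, A x) := by
    refine L2norm_le_mul_sqrt_integral hΩopen.measurableSet (by positivity) iA hA0 fun x hx => ?_
    have e : (fun y => Real.exp (φ y / h) • u y) =ᶠ[𝓝 x] fun y => Real.exp (τ * ψ y) • u y := by
      filter_upwards [hφψ x hx] with y hy
      rw [hy, hexp]
    rw [e.fderiv_eq, norm_smul, mul_pow, mul_pow, Real.sq_sqrt (by positivity),
      Real.norm_eq_abs, sq_abs, mul_assoc]
    gcongr
    refine (norm_fderiv_exp_smul_sq_le hψ hu τ).trans ?_
    calc _ ≤ 2 * Real.exp (τ * ψ x) ^ 2 *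
          (M * ‖fderiv ℝ u x‖ ^ 2 + M * (τ ^ 2 * ‖u x‖ ^ 2)) := by
          gcongr
          · exact le_mul_of_one_le_left (by positivity) hM
          · exact H.grad_le x hx
      _ = 2 * M * A x := by rw [hA]; ring
  have h3 : L2norm Ω (fun x =>
      ‖Real.exp (φ x / h) • (eLap u x + fderiv ℝ u x (X x) + q x * u x)‖) =
      √(∫ x, Real.exp (τ * ψ x) ^ 2 *
        ‖eLap u x + fderiv ℝ u x (Y x) + p x * u x‖ ^ 2) := by
    rw [L2norm_eq_sqrt]
    refine congrArg Real.sqrt ((setIntegral_congr_fun hΩopen.measurableSet fun x hx => ?_).trans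
      (setIntegral_eq_integral_of_forall_compl_eq_zero fun x hx => ?_))
    · have hx' := subset_closure hx
      simp only [(hφψ x hx).eq_of_nhds, (hYX x hx').self_of_nhds, (hpq x hx').self_of_nhds, hexp,
        norm_smul, mul_pow, Real.norm_of_nonneg (Real.exp_pos _).le]
    · have hxu : x ∉ tsupport u := fun h => hx (hsupp h)
      simp [hd0 x hxu, (hu0 x hxu).eq_of_nhds, eLap_eq_zero (hu0 x hxu)]
  rw [h3]
  have h4 : √(∫ x, A x) ≤ √K * √(∫ x, Real.exp (τ * ψ x) ^ 2 *
      ‖eLap u x + fderiv ℝ u x (Y x) + p x * u x‖ ^ 2) := by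
    rw [← Real.sqrt_mul hK0.le]
    exact Real.sqrt_le_sqrt (est τ hτ u hu hcs hsupp)
  calc _ ≤ h * √(∫ x, A x) + h * √(2 * M) * √(∫ x, A x) := add_le_add h1 h2
    _ = (1 + √(2 * M)) * h * √(∫ x, A x) := by ring
    _ ≤ (1 + √(2 * M)) * h * (√K * _) := by gcongr
    _ = _ := by ring
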